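/- Assume V is real-valued and θ₀, θ_R, θ₀', θ_R' ∈ [0,2π). Then for every z ∈ ℂ\[e₀,∞), the resolvent difference (H_{θ₀',θ_R'} − zI)^{-1} − (H_{θ₀,θ_R} − zI)^{-1} is trace class on L²((0,R);dx) and tr_{L²}((H_{θ₀',θ_R'} − zI)^{-1} − (H_{θ₀,θ_R} − zI)^{-1}) = −tr_{ℂ²}([Λ_{θ₀,θ_R}^{θ₀',θ_R'}(z)]^{-1} (d/dz)Λ_{θ₀,θ_R}^{θ₀',θ_R'}(z)) = −(d/dz) ln det_{ℂ²}(Λ_{θ₀,θ_R}^{θ₀',θ_R'}(z)). -/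

import Mathlib

open MeasureTheory Filter
open scoped InnerProductSpace

noncomputable section
open scoped Classical


variable {H : Type*} [NormedAddCommGroup H] [InnerProductSpace ℂ H] [CompleteSpace H]

/-- `T` is the (bounded, everywhere defined) inverse of `A - z·I`. -/
def IsResolvent (A : H →ₗ.[ℂ] H) (z : ℂ) (T : H →L[ℂ] H) : Prop :=
  (∀ x : H, ∃ hx : T x ∈ A.domain, A ⟨T x, hx⟩ - z • T x = x) ∧
  ∀ u : A.domain, T (A u - z • (u : H)) = (u : H)

/-- The resolvent set of an unbounded operator. -/
def resolventSetP (A : H →ₗ.[ℂ] H) : Set ℂ := {z | ∃ T, IsResolvent A z T}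

/-- The spectrum of an unbounded operator. -/
def specP (A : H →ₗ.[ℂ] H) : Set ℂ := (resolventSetP A)ᶜ

/-- The resolvent `(A - z·I)⁻¹` (junk value `0` off the resolvent set). -/
def res (A : H →ₗ.[ℂ] H) (z : ℂ) : H →L[ℂ] H :=
  if h : ∃ T, IsResolvent A z T then h.choose else 0

/-- The operator `A + t·I` (same domain). -/
def shiftP (A : H →ₗ.[ℂ] H) (t : ℂ) : H →ₗ.[ℂ] H :=
  ⟨A.domain, A.toFun + t • A.domain.subtype⟩

/-- `A` is of positive type: `(-∞,0] ⊆ ρ(A)` and `sup_{t ≥ 0} ‖(1+t)(A+t)⁻¹‖ < ∞`. -/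
def IsPositiveTypeP (A : H →ₗ.[ℂ] H) : Prop :=
  (∀ x : ℝ, x ≤ 0 → (x : ℂ) ∈ resolventSetP A) ∧
  ∃ M : ℝ, ∀ t : ℝ, 0 ≤ t → (1 + t) * ‖res A (-(t : ℂ))‖ ≤ M

/-- The open sector of half-opening angle `ω` about the positive reals
(`(0,∞)` for `ω = 0`). -/
def sectorS (ω : ℝ) : Set ℂ :=
  if ω = 0 then (fun x : ℝ => (x : ℂ)) '' Set.Ioi 0
  else {z : ℂ | z ≠ 0 ∧ |Complex.arg z| < ω}

/-- `A` is sectorial of angle `ω`. -/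
def IsSectorialP (A : H →ₗ.[ℂ] H) (ω : ℝ) : Prop :=
  specP A ⊆ closure (sectorS ω) ∧
  ∀ ω' : ℝ, ω < ω' → ω' < Real.pi →
    ∃ M : ℝ, ∀ z ∈ (closure (sectorS ω'))ᶜ, ‖z‖ * ‖res A z‖ ≤ M

/-- The shifted sector `-t₀ + S_ω`. -/
def shiftedSector (t0 ω : ℝ) : Set ℂ := (fun w => -(t0 : ℂ) + w) '' sectorS ω

/-- The region `ℂ \ closure (-t₀ + S_ω)`. -/
def offSector (t0 ω : ℝ) : Set ℂ := (closure (shiftedSector t0 ω))ᶜ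

/-- The bounded operator `(A - z·I)^{-1/2}`, defined by the Balakrishnan-type formula
`(1/π) ∫₀^∞ t^{-1/2} (A + (t - z)·I)⁻¹ dt`. -/
def negSqrt (A : H →ₗ.[ℂ] H) (z : ℂ) : H →L[ℂ] H :=
  ((Real.pi : ℂ))⁻¹ • ∫ t in Set.Ioi (0 : ℝ), ((Real.sqrt t : ℂ))⁻¹ • res A (z - t)

/-- Trace-class (nuclear) bounded operators, characterized by
`sup { ∑ |⟨eᵢ, T fᵢ⟩| : (eᵢ), (fᵢ) finite orthonormal families } < ∞`. -/
def IsTraceClass (T : H →L[ℂ] H) : Prop :=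
  ∃ C : ℝ, ∀ (n : ℕ) (e f : Fin n → H), Orthonormal ℂ e → Orthonormal ℂ f →
    ∑ i, ‖⟪e i, T (f i)⟫_ℂ‖ ≤ C

/-- The trace norm `‖T‖₁`. -/
def traceNorm (T : H →L[ℂ] H) : ℝ :=
  sSup {s : ℝ | ∃ (n : ℕ) (e f : Fin n → H), Orthonormal ℂ e ∧ Orthonormal ℂ f ∧
    s = ∑ i, ‖⟪e i, T (f i)⟫_ℂ‖}

/-- The trace of a (trace-class) operator, computed in the Hilbert basis `b`. -/
def traceH (b : HilbertBasis ℕ ℂ H) (T : H →L[ℂ] H) : ℂ :=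
  ∑' n, ⟪(b n : H), T (b n)⟫_ℂ

/-- The Fredholm determinant `det (I + T)` (for `T` trace class), computed as the limit of
finite-section determinants along the Hilbert basis `b`. -/
def detI (b : HilbertBasis ℕ ℂ H) (T : H →L[ℂ] H) : ℂ :=
  limUnder atTop fun F : Finset ℕ =>
    Matrix.det (Matrix.of fun i j : F =>
      (if (i : ℕ) = (j : ℕ) then (1 : ℂ) else 0) + ⟪(b (i : ℕ) : H), T (b (j : ℕ))⟫_ℂ)


/-! ### One-dimensional Schrödinger operators on `[0,R]` -/

/-- The underlying Hilbert space `L²((0,R); dx)`. -/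
abbrev SchSp (Rr : ℝ) :=
  MeasureTheory.Lp ℂ 2 (MeasureTheory.volume.restrict (Set.Ioo (0 : ℝ) Rr))

/-- `u` (with derivative `du`) solves `-u'' + V u = z u` on `[0,R]`, with
`u, u' ∈ AC([0,R])` (the second derivative being encoded in integrated form). -/
def SolODE (Rr : ℝ) (V : ℝ → ℂ) (z : ℂ) (u du : ℝ → ℂ) : Prop :=
  (∀ x ∈ Set.Icc (0 : ℝ) Rr, HasDerivWithinAt u (du x) (Set.Icc (0 : ℝ) Rr) x) ∧
  ∀ x ∈ Set.Icc (0 : ℝ) Rr, du x = du 0 + ∫ t in (0 : ℝ)..x, (V t - z) * u t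

/-- The boundary trace `γ_{θ₀,θ_R}(u) = (cos θ₀ u(0) + sin θ₀ u'(0),
cos θ_R u(R) - sin θ_R u'(R))`. -/
def bdryC (Rr : ℝ) (t0 tR : ℂ) (u du : ℝ → ℂ) : Fin 2 → ℂ :=
  ![Complex.cos t0 * u 0 + Complex.sin t0 * du 0,
    Complex.cos tR * u Rr - Complex.sin tR * du Rr]

/-- `g` (with derivative `dg`) is an absolutely continuous representative of `f ∈ L²`
satisfying `-g'' + V g - z g = h` (in integrated form, with `h₀` a representative of
`h ∈ L²`); i.e. `f` represents `(H - z)⁻¹ h`. -/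
def SolvesAt (Rr : ℝ) (V : ℝ → ℂ) (z : ℂ) (f h : SchSp Rr) (g dg : ℝ → ℂ) : Prop :=
  (∀ᵐ x ∂(MeasureTheory.volume.restrict (Set.Ioo (0 : ℝ) Rr)), f x = g x) ∧
  (∀ x ∈ Set.Icc (0 : ℝ) Rr, HasDerivWithinAt g (dg x) (Set.Icc (0 : ℝ) Rr) x) ∧
  ∃ h0 : ℝ → ℂ,
    (∀ᵐ x ∂(MeasureTheory.volume.restrict (Set.Ioo (0 : ℝ) Rr)), h x = h0 x) ∧
    ∀ x ∈ Set.Icc (0 : ℝ) Rr,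
      dg x = dg 0 + ∫ t in (0 : ℝ)..x, (V t * g t - z * g t - h0 t)

/-- `Hop` is the Schrödinger operator `H_{θ₀,θ_R} = -d²/dx² + V` in `L²((0,R); dx)` with
separated boundary conditions `γ_{θ₀,θ_R}(g) = 0`, characterized through its graph. -/
def IsSchrodingerOp (Rr : ℝ) (V : ℝ → ℂ) (t0 tR : ℂ)
    (Hop : SchSp Rr →ₗ.[ℂ] SchSp Rr) : Prop :=
  ∀ f h : SchSp Rr, (f, h) ∈ Hop.graph ↔
    ∃ g dg : ℝ → ℂ, SolvesAt Rr V 0 f h g dg ∧ bdryC Rr t0 tR g dg = 0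

/-- `Λ` is the boundary data map `Λ_{θ₀,θ_R}^{θ₀',θ_R'}(z)`: for every solution `u` of
`-u'' + Vu = zu`, `Λ` maps `γ_{θ₀,θ_R}(u)` to `γ_{θ₀',θ_R'}(u)`. -/
def IsBoundaryDataMap (Rr : ℝ) (V : ℝ → ℂ) (t0 tR t0' tR' : ℂ) (z : ℂ)
    (Λ : Matrix (Fin 2) (Fin 2) ℂ) : Prop :=
  ∀ u du : ℝ → ℂ, SolODE Rr V z u du →
    Λ.mulVec (bdryC Rr t0 tR u du) = bdryC Rr t0' tR' u du

/-- `G` is the map `γ_{θ₀',θ_R'} ∘ (Hop - z)⁻¹ : L²((0,R)) → ℂ²`. -/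
def IsBdryResolventMap (Rr : ℝ) (V : ℝ → ℂ) (t0' tR' : ℂ) (z : ℂ)
    (Hop : SchSp Rr →ₗ.[ℂ] SchSp Rr)
    (G : SchSp Rr →L[ℂ] EuclideanSpace ℂ (Fin 2)) : Prop :=
  ∀ (h : SchSp Rr) (g dg : ℝ → ℂ), SolvesAt Rr V z (res Hop z h) h g dg →
    ∀ i : Fin 2, G h i = bdryC Rr t0' tR' g dg i

/-- The region `ℂ \ [c, ∞)`. -/
def offCut (c : ℝ) : Set ℂ := {z : ℂ | z.im ≠ 0 ∨ z.re < c}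

/-- `N` is the family `z ↦ (Hop - z)^{-1/2}`, defined via the spectral theorem with branch
cut along `[c, ∞)` (`c = inf σ(Hop)`): analytic on `ℂ \ [c,∞)`, squaring to the resolvent,
and positive (self-adjoint) for real `z < c`. -/
def IsSqrtResFam (Rr : ℝ) (Hop : SchSp Rr →ₗ.[ℂ] SchSp Rr) (c : ℝ)
    (N : ℂ → (SchSp Rr →L[ℂ] SchSp Rr)) : Prop :=
  (∀ z ∈ offCut c, (N z).comp (N z) = res Hop z) ∧
  (∀ x : ℝ, x < c →
    (∀ v w : SchSp Rr, ⟪N (x : ℂ) v, w⟫_ℂ = ⟪v, N (x : ℂ) w⟫_ℂ) ∧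
    ∀ v : SchSp Rr, 0 ≤ (⟪v, N (x : ℂ) v⟫_ℂ).re) ∧
  DifferentiableOn ℂ N (offCut c)

/-- The infimum `e₀ = inf(σ(Hop) ∪ σ(Hop'))`. -/
def einf (Rr : ℝ) (Hop Hop' : SchSp Rr →ₗ.[ℂ] SchSp Rr) : ℝ :=
  sInf {x : ℝ | (x : ℂ) ∈ specP Hop ∪ specP Hop'}

/-- The infimum of the spectrum of a single operator. -/
def einf1 (Rr : ℝ) (Hop : SchSp Rr →ₗ.[ℂ] SchSp Rr) : ℝ :=
  sInf {x : ℝ | (x : ℂ) ∈ specP Hop}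

section AbstractResolvent

set_option linter.unusedSectionVars false

theorem inner_self_eq_ofReal_norm_sq (u : H) : ⟪u, u⟫_ℂ = ((‖u‖ ^ 2 : ℝ) : ℂ) := by
  rw [inner_self_eq_norm_sq_to_K]; simp

theorem isResolvent_res {A : H →ₗ.[ℂ] H} {z : ℂ} (hz : z ∈ resolventSetP A) :
    IsResolvent A z (res A z) := by
  have h : ∃ T, IsResolvent A z T := hz
  rw [res, dif_pos h]
  exact h.choose_spec

theorem IsResolvent.mem_graph {A : H →ₗ.[ℂ] H} {z : ℂ} {T : H →L[ℂ] H} (hT : IsResolvent A z T)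
    (x : H) : (T x, x + z • T x) ∈ A.graph := by
  obtain ⟨hx, h⟩ := hT.1 x
  rw [LinearPMap.mem_graph_iff]
  exact ⟨⟨T x, hx⟩, rfl, sub_eq_iff_eq_add.1 h⟩

theorem IsResolvent.eq_of_mem_graph {A : H →ₗ.[ℂ] H} {z : ℂ} {T : H →L[ℂ] H}
    (hT : IsResolvent A z T) {f h : H} (hf : (f, h) ∈ A.graph) : T (h - z • f) = f := by
  rw [LinearPMap.mem_graph_iff] at hf
  obtain ⟨y, rfl, rfl⟩ := hf
  exact hT.2 y

theorem IsResolvent.eq_zero_of_mem_graph {A : H →ₗ.[ℂ] H} {z : ℂ} {T : H →L[ℂ] H}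
    (hT : IsResolvent A z T) {f : H} (hf : (f, z • f) ∈ A.graph) : f = 0 := by
  rw [← hT.eq_of_mem_graph hf]; simp

/-- A self-adjoint operator has `z` in its resolvent set as soon as `A - z` and `A - conj z` are
both bounded below. -/
theorem mem_resolventSetP_of_bounded_below {A : H →ₗ.[ℂ] H} (hA : IsSelfAdjoint A) {z : ℂ} {c : ℝ}
    (hc : 0 < c) (h1 : ∀ u : A.domain, c * ‖(u : H)‖ ≤ ‖A u - z • (u : H)‖)
    (h2 : ∀ u : A.domain, c * ‖(u : H)‖ ≤ ‖A u - (starRingEnd ℂ z) • (u : H)‖) :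
    z ∈ resolventSetP A := by
  have hcl : IsClosed (A.graph : Set (H × H)) := hA.isClosed
  have : CompleteSpace A.graph := hcl.completeSpace_coe
  let T : A.graph →L[ℂ] H :=
    (ContinuousLinearMap.snd ℂ H H - z • ContinuousLinearMap.fst ℂ H H).comp A.graph.subtypeL
  have hTapp : ∀ p : A.graph, T p = (p : H × H).2 - z • (p : H × H).1 := fun p => rfl
  have hbd : ∀ p : A.graph, ‖p‖ ≤ (1 / c + 1 + ‖z‖ / c) * ‖T p‖ := by
    rintro ⟨⟨f, h⟩, hp⟩
    rw [hTapp]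
    rw [LinearPMap.mem_graph_iff] at hp
    obtain ⟨y, hy, hy'⟩ := hp
    simp only at hy hy' ⊢
    subst hy hy'
    have hb := h1 y
    have hy1 : ‖(y : H)‖ ≤ 1 / c * ‖A y - z • (y : H)‖ := by
      rw [div_mul_eq_mul_div, le_div_iff₀ hc]; linarith
    have hy2 : ‖A y‖ ≤ ‖A y - z • (y : H)‖ + ‖z‖ * ‖(y : H)‖ := by
      calc ‖A y‖ = ‖(A y - z • (y : H)) + z • (y : H)‖ := by simp
        _ ≤ _ := (norm_add_le _ _).trans (by rw [norm_smul])
    have hy3 : ‖z‖ * ‖(y : H)‖ ≤ ‖z‖ / c * ‖A y - z • (y : H)‖ := by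
      calc ‖z‖ * ‖(y : H)‖ ≤ ‖z‖ * (1 / c * ‖A y - z • (y : H)‖) := by gcongr
        _ = _ := by ring
    have hn := norm_nonneg (A y - z • (y : H))
    have hzc : 0 ≤ ‖z‖ / c * ‖A y - z • (y : H)‖ := by positivity
    have hcc : 0 ≤ 1 / c * ‖A y - z • (y : H)‖ := by positivity
    change max ‖(y : H)‖ ‖A y‖ ≤ _
    apply max_le <;> linarith
  have hanti : AntilipschitzWith (Real.toNNReal (1 / c + 1 + ‖z‖ / c)) T := by
    refine T.antilipschitz_of_bound fun x => ?_
    rw [Real.coe_toNNReal _ (by positivity)]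
    exact hbd x
  have hclr : IsClosed (LinearMap.range (T : A.graph →ₗ[ℂ] H) : Set H) := by
    exact hanti.isClosed_range T.uniformContinuous
  have hrange : LinearMap.range (T : A.graph →ₗ[ℂ] H) = ⊤ := by
    have hcs : CompleteSpace (LinearMap.range (T : A.graph →ₗ[ℂ] H)) := hclr.completeSpace_coe
    rw [← Submodule.orthogonal_eq_bot_iff, Submodule.eq_bot_iff]
    intro y hy
    rw [Submodule.mem_orthogonal'] at hy
    have hy' : ∀ u : A.domain, ⟪(starRingEnd ℂ z) • y, (u : H)⟫_ℂ = ⟪y, A u⟫_ℂ := by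
      intro u
      have := hy (A u - z • (u : H)) ⟨⟨((u : H), A u), LinearPMap.mem_graph A u⟩, rfl⟩
      rw [inner_sub_right, inner_smul_right, sub_eq_zero] at this
      rw [inner_smul_left, this]
      simp
    have hmem : y ∈ (LinearPMap.adjoint A).domain :=
      LinearPMap.mem_adjoint_domain_of_exists y ⟨_, hy'⟩
    have happ := LinearPMap.adjoint_apply_eq hA.dense_domain ⟨y, hmem⟩ hy'
    have hgr : (y, (starRingEnd ℂ z) • y) ∈ A.graph := by
      have : (y, (starRingEnd ℂ z) • y) ∈ (LinearPMap.adjoint A).graph := by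
        rw [LinearPMap.mem_graph_iff]
        exact ⟨⟨y, hmem⟩, rfl, happ⟩
      rwa [LinearPMap.isSelfAdjoint_def.1 hA] at this
    rw [LinearPMap.mem_graph_iff] at hgr
    obtain ⟨u, hu, hu'⟩ := hgr
    simp only at hu hu'
    have := h2 u
    rw [hu', hu, sub_self, norm_zero] at this
    have h0 : ‖y‖ ≤ 0 := by
      by_contra hcon
      push Not at hcon
      nlinarith
    exact norm_le_zero_iff.1 h0
  have hker : LinearMap.ker (T : A.graph →ₗ[ℂ] H) = ⊥ := LinearMap.ker_eq_bot.2 hanti.injective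
  let E := ContinuousLinearEquiv.ofBijective T hker hrange
  have hE : ∀ p, E p = T p := fun p => rfl
  refine ⟨(ContinuousLinearMap.fst ℂ H H).comp
    (A.graph.subtypeL.comp (E.symm : H →L[ℂ] A.graph)), fun x => ?_, fun u => ?_⟩
  · have hp := (E.symm x).2
    have hx : T (E.symm x) = x := by rw [← hE]; simp
    rw [hTapp] at hx
    rw [LinearPMap.mem_graph_iff] at hp
    obtain ⟨y, hy, hy'⟩ := hp
    have e : (((ContinuousLinearMap.fst ℂ H H).comp
      (A.graph.subtypeL.comp (E.symm : H →L[ℂ] A.graph))) x) = (y : H) := by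
      rw [hy]; rfl
    simp only [e]
    refine ⟨y.2, ?_⟩
    rw [← hy, ← hy'] at hx
    exact hx
  · have : E ⟨((u : H), A u), LinearPMap.mem_graph A u⟩ = A u - z • (u : H) := rfl
    rw [← this]
    simp

theorem mem_resolventSetP_of_im_ne_zero {A : H →ₗ.[ℂ] H} (hA : IsSelfAdjoint A) {z : ℂ}
    (hz : z.im ≠ 0) : z ∈ resolventSetP A := by
  have hsym : ∀ u : A.domain, (⟪(u : H), A u⟫_ℂ).im = 0 := by
    intro u
    have h := LinearPMap.adjoint_isFormalAdjoint hA.dense_domain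
    rw [LinearPMap.isSelfAdjoint_def.1 hA] at h
    have h' := h u u
    rw [← inner_conj_symm] at h'
    exact Complex.conj_eq_iff_im.1 h'
  have key : ∀ w : ℂ, ∀ u : A.domain, |w.im| * ‖(u : H)‖ ≤ ‖A u - w • (u : H)‖ := by
    intro w u
    have e : (⟪(u : H), A u - w • (u : H)⟫_ℂ).im = -(w.im * ‖(u : H)‖ ^ 2) := by
      rw [inner_sub_right, inner_smul_right, inner_self_eq_ofReal_norm_sq, Complex.sub_im, hsym,
        Complex.im_mul_ofReal, zero_sub]
    have h1 : |w.im| * ‖(u : H)‖ ^ 2 ≤ ‖(u : H)‖ * ‖A u - w • (u : H)‖ := by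
      calc |w.im| * ‖(u : H)‖ ^ 2 = |(⟪(u : H), A u - w • (u : H)⟫_ℂ).im| := by
            rw [e, abs_neg, abs_mul, abs_of_nonneg (sq_nonneg ‖(u : H)‖)]
        _ ≤ ‖⟪(u : H), A u - w • (u : H)⟫_ℂ‖ := Complex.abs_im_le_norm _
        _ ≤ _ := norm_inner_le_norm _ _
    rcases eq_or_lt_of_le (norm_nonneg (u : H)) with h0 | h0
    · rw [← h0]; simp
    · have : ‖(u : H)‖ * (|w.im| * ‖(u : H)‖) ≤ ‖(u : H)‖ * ‖A u - w • (u : H)‖ := by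
        linarith [h1, sq ‖(u : H)‖]
      exact le_of_mul_le_mul_left this h0
  refine mem_resolventSetP_of_bounded_below hA (abs_pos.2 hz) (key z) fun u => ?_
  simpa using key (starRingEnd ℂ z) u

theorem mem_resolventSetP_of_semibounded {A : H →ₗ.[ℂ] H} (hA : IsSelfAdjoint A) {C x : ℝ}
    (hC : ∀ u : A.domain, -C * ‖(u : H)‖ ^ 2 ≤ (⟪(u : H), A u⟫_ℂ).re) (hx : x < -C) :
    (x : ℂ) ∈ resolventSetP A := by
  have key : ∀ u : A.domain, (-C - x) * ‖(u : H)‖ ≤ ‖A u - (x : ℂ) • (u : H)‖ := by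
    intro u
    have e : (⟪(u : H), A u - (x : ℂ) • (u : H)⟫_ℂ).re
        = (⟪(u : H), A u⟫_ℂ).re - x * ‖(u : H)‖ ^ 2 := by
      rw [inner_sub_right, inner_smul_right, inner_self_eq_ofReal_norm_sq, Complex.sub_re,
        Complex.re_ofReal_mul, Complex.ofReal_re]
    have h1 : (⟪(u : H), A u - (x : ℂ) • (u : H)⟫_ℂ).re ≤ ‖(u : H)‖ * ‖A u - (x : ℂ) • (u : H)‖ :=
      (Complex.re_le_norm _).trans (norm_inner_le_norm _ _)
    rcases eq_or_lt_of_le (norm_nonneg (u : H)) with h0 | h0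
    · rw [← h0]; simp
    · have : ‖(u : H)‖ * ((-C - x) * ‖(u : H)‖) ≤ ‖(u : H)‖ * ‖A u - (x : ℂ) • (u : H)‖ := by
        nlinarith [hC u]
      exact le_of_mul_le_mul_left this h0
  refine mem_resolventSetP_of_bounded_below hA (by linarith : 0 < -C - x) key fun u => ?_
  simpa using key u

end AbstractResolvent

section AbstractTrace

set_option linter.unusedSectionVars false

theorem isTraceClass_of_finite_rank {ι : Type*} [Fintype ι] {T : H →L[ℂ] H} {ψ : ι → H}
    {l : ι → H →L[ℂ] ℂ} (hT : ∀ h, T h = ∑ i, l i h • ψ i) : IsTraceClass T := by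
  let v : ι → H := fun i => (InnerProductSpace.toDual ℂ H).symm (l i)
  have hv : ∀ i h, l i h = ⟪v i, h⟫_ℂ := fun i h => by
    simp [v, InnerProductSpace.toDual_symm_apply]
  refine ⟨∑ i, (‖ψ i‖ ^ 2 + ‖v i‖ ^ 2) / 2, fun n e f he hf => ?_⟩
  calc ∑ k, ‖⟪e k, T (f k)⟫_ℂ‖
      ≤ ∑ k, ∑ i, (‖⟪e k, ψ i⟫_ℂ‖ ^ 2 + ‖⟪f k, v i⟫_ℂ‖ ^ 2) / 2 := by
        refine Finset.sum_le_sum fun k _ => ?_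
        rw [hT, inner_sum]
        refine (norm_sum_le _ _).trans (Finset.sum_le_sum fun i _ => ?_)
        rw [inner_smul_right, norm_mul, hv, norm_inner_symm (v i)]
        nlinarith [sq_nonneg (‖⟪e k, ψ i⟫_ℂ‖ - ‖⟪f k, v i⟫_ℂ‖)]
    _ = ∑ i, (∑ k, ‖⟪e k, ψ i⟫_ℂ‖ ^ 2 + ∑ k, ‖⟪f k, v i⟫_ℂ‖ ^ 2) / 2 := by
        rw [Finset.sum_comm]
        refine Finset.sum_congr rfl fun i _ => ?_
        rw [← Finset.sum_div, Finset.sum_add_distrib]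
    _ ≤ _ := by
        refine Finset.sum_le_sum fun i _ => ?_
        have h1 := he.sum_inner_products_le (ψ i) (s := Finset.univ)
        have h2 := hf.sum_inner_products_le (v i) (s := Finset.univ)
        linarith

theorem traceH_of_finite_rank (b : HilbertBasis ℕ ℂ H) {ι : Type*} [Fintype ι] {T : H →L[ℂ] H}
    {ψ : ι → H} {l : ι → H →L[ℂ] ℂ} (hT : ∀ h, T h = ∑ i, l i h • ψ i) :
    traceH b T = ∑ i, l i (ψ i) := by
  let v : ι → H := fun i => (InnerProductSpace.toDual ℂ H).symm (l i)
  have hv : ∀ i h, l i h = ⟪v i, h⟫_ℂ := fun i h => by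
    simp [v, InnerProductSpace.toDual_symm_apply]
  have key : HasSum (fun n => ⟪(b n : H), T (b n)⟫_ℂ) (∑ i, l i (ψ i)) := by
    have := hasSum_sum (s := Finset.univ) fun i _ => b.hasSum_inner_mul_inner (v i) (ψ i)
    simp only [← hv] at this
    have e : (fun n => ⟪(b n : H), T (b n)⟫_ℂ) =
        fun n => ∑ i, l i (b n) * ⟪(b n : H), ψ i⟫_ℂ := by
      funext n
      rw [hT, inner_sum]
      exact Finset.sum_congr rfl fun i _ => inner_smul_right _ _ _
    rw [e]
    exact this
  exact key.tsum_eq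

/-- Linearly independent vectors in a Hilbert space have a continuous biorthogonal system. -/
theorem exists_biorthogonal {ι : Type*} [Fintype ι] [DecidableEq ι] {ψ : ι → H}
    (hψ : LinearIndependent ℂ ψ) :
    ∃ φ : ι → H →L[ℂ] ℂ, ∀ i j, φ i (ψ j) = if i = j then 1 else 0 := by
  let S := Submodule.span ℂ (Set.range ψ)
  have : FiniteDimensional ℂ S := FiniteDimensional.span_of_finite ℂ (Set.finite_range ψ)
  let B := Module.Basis.span hψ
  refine ⟨fun i => (LinearMap.toContinuousLinearMap (B.coord i)).comp S.orthogonalProjectionOnto,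
    fun i j => ?_⟩
  have h1 : ψ j = ((B j : S) : H) := (congrArg Subtype.val (Module.Basis.span_apply hψ j)).symm
  rw [h1]
  simp [Finsupp.single_apply, eq_comm]

theorem hasDerivWithinAt_of_eq_add_sub_mul {F g : ℂ → ℂ} {g₀ z : ℂ} {Ω : Set ℂ}
    (hF : ∀ w ∈ Ω, F w = F z + (w - z) * g w) (hg : Tendsto g (nhdsWithin z Ω) (nhds g₀)) :
    HasDerivWithinAt F g₀ Ω z := by
  rw [hasDerivWithinAt_iff_tendsto_slope]
  refine Tendsto.congr' ?_ (hg.mono_left (nhdsWithin_mono z Set.sdiff_subset))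
  filter_upwards [self_mem_nhdsWithin] with w hw
  have hne : w - z ≠ 0 := sub_ne_zero.2 hw.2
  rw [slope_def_field, hF w hw.1]
  field_simp
  ring

/-- Strong continuity of `w ↦ x + (w - z) (A - w)⁻¹ x` at `z`, within the resolvent set. -/
theorem tendsto_add_sub_smul_res {A : H →ₗ.[ℂ] H} {Ω : Set ℂ} {z : ℂ}
    (hΩ : ∀ w ∈ Ω, w ∈ resolventSetP A) (hz : z ∈ resolventSetP A) (x : H) :
    Tendsto (fun w => x + (w - z) • res A w x) (nhdsWithin z Ω) (nhds x) := by
  have hlim : Tendsto (fun w : ℂ => ‖w - z‖ * ‖res A z‖) (nhdsWithin z Ω) (nhds 0) := by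
    have : Continuous fun w : ℂ => ‖w - z‖ * ‖res A z‖ := by fun_prop
    have := (this.tendsto z).mono_left (nhdsWithin_le_nhds (s := Ω))
    simpa using this
  have hbd : ∀ᶠ w in nhdsWithin z Ω,
      ‖(w - z) • res A w x‖ ≤ ‖w - z‖ * ‖res A z‖ * (2 * ‖x‖) := by
    filter_upwards [self_mem_nhdsWithin,
      hlim.eventually (gt_mem_nhds (by norm_num : (0 : ℝ) < 1 / 2))] with w hw hsmall
    have h1 := (isResolvent_res hz).eq_of_mem_graph ((isResolvent_res (hΩ w hw)).mem_graph x)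
    set r := res A w x with hr
    have h2 : r = res A z (x + (w - z) • r) := by
      rw [← h1]
      congr 1
      rw [h1]
      module
    have h3 : ‖r‖ ≤ ‖res A z‖ * (‖x‖ + ‖w - z‖ * ‖r‖) := by
      calc ‖r‖ = ‖res A z (x + (w - z) • r)‖ := by rw [← h2]
        _ ≤ ‖res A z‖ * ‖x + (w - z) • r‖ := (res A z).le_opNorm _
        _ ≤ _ := by
          gcongr
          exact (norm_add_le _ _).trans (by rw [norm_smul])
    have h4 : ‖r‖ ≤ ‖res A z‖ * (2 * ‖x‖) := by
      nlinarith [norm_nonneg r]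
    rw [norm_smul, mul_assoc]
    gcongr
  have h0 : Tendsto (fun w => (w - z) • res A w x) (nhdsWithin z Ω) (nhds 0) := by
    refine squeeze_zero_norm' hbd ?_
    simpa using hlim.mul_const (2 * ‖x‖)
  simpa using h0.const_add x

/-- Abstract form of the trace formula.  `G` collects tuples `(f, h, c, c')`, where `h` is the
image of `f` under a maximal operator and `c`, `c'` are the two boundary traces of `f`; `A` and
`A'` are the restrictions of the maximal operator to the kernels of the two traces. -/
structure IsBoundaryRelation (G : Submodule ℂ (H × H × (Fin 2 → ℂ) × (Fin 2 → ℂ)))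
    (A A' : H →ₗ.[ℂ] H) : Prop where
  trace_zero : ∀ {c c'}, ((0, 0, c, c') : H × H × (Fin 2 → ℂ) × (Fin 2 → ℂ)) ∈ G → c = 0 ∧ c' = 0
  graph_left : ∀ {f h}, (f, h) ∈ A.graph ↔ ∃ c', (f, h, 0, c') ∈ G
  graph_right : ∀ {f h}, (f, h) ∈ A'.graph ↔ ∃ c, (f, h, c, 0) ∈ G
  exists_sol : ∀ z : ℂ, ∃ (ψ : Fin 2 → H) (c c' : Fin 2 → Fin 2 → ℂ),
    LinearIndependent ℂ ψ ∧ ∀ i, (ψ i, z • ψ i, c i, c' i) ∈ G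

namespace IsBoundaryRelation

variable {G : Submodule ℂ (H × H × (Fin 2 → ℂ) × (Fin 2 → ℂ))} {A A' : H →ₗ.[ℂ] H}

theorem sum_mem {z : ℂ} {ψ : Fin 2 → H} {c c' : Fin 2 → Fin 2 → ℂ}
    (h : ∀ i, (ψ i, z • ψ i, c i, c' i) ∈ G) (a : Fin 2 → ℂ) :
    (∑ i, a i • ψ i, z • ∑ i, a i • ψ i, ∑ i, a i • c i, ∑ i, a i • c' i) ∈ G := by
  have := G.sum_mem (t := Finset.univ) fun i _ => G.smul_mem (a i) (h i)
  convert this using 1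
  simp only [Fin.sum_univ_two, Prod.smul_mk, Prod.mk_add_mk, smul_add, smul_comm z]

/-- Off the spectrum there is a basis of solutions with prescribed boundary traces. -/
theorem exists_normalized (hG : IsBoundaryRelation G A A') {z : ℂ} (hz : z ∈ resolventSetP A) :
    ∃ (ψ : Fin 2 → H) (c' : Fin 2 → Fin 2 → ℂ), LinearIndependent ℂ ψ ∧
      ∀ i, (ψ i, z • ψ i, Pi.single i 1, c' i) ∈ G := by
  obtain ⟨ψ, c, c', hψ, hmem⟩ := hG.exists_sol z
  have hR := isResolvent_res hz
  have hc : LinearIndependent ℂ c := by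
    rw [Fintype.linearIndependent_iff] at hψ ⊢
    intro a ha
    refine hψ a (hR.eq_zero_of_mem_graph (hG.graph_left.2 ⟨∑ i, a i • c' i, ?_⟩))
    have := sum_mem hmem a
    rwa [ha] at this
  let B := basisOfLinearIndependentOfCardEqFinrank hc (by simp)
  have hB : ∀ j, B j = c j := fun j => by simp [B]
  have hsum : ∀ i : Fin 2, ∑ j, B.repr (Pi.single i 1) j • c j = Pi.single i (1 : ℂ) := by
    intro i
    simp only [← hB]
    exact B.sum_repr _
  have hmem' : ∀ i, (∑ j, B.repr (Pi.single i 1) j • ψ j, z • ∑ j, B.repr (Pi.single i 1) j • ψ j,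
      Pi.single i 1, ∑ j, B.repr (Pi.single i 1) j • c' j) ∈ G := fun i => by
    have := sum_mem hmem (B.repr (Pi.single i 1))
    rwa [hsum] at this
  refine ⟨_, _, ?_, hmem'⟩
  rw [Fintype.linearIndependent_iff]
  intro a ha
  have := sum_mem hmem' a
  rw [ha, smul_zero] at this
  have h0 := (hG.trace_zero this).1
  intro i
  have := congrFun h0 i
  simpa [Finset.sum_apply, Pi.single_apply] using this

/-- The difference of the resolvents, in terms of a normalized basis of solutions `ψ` and a
biorthogonal system `φ`. -/
theorem resolvent_sub (hG : IsBoundaryRelation G A A') {z : ℂ} (hz : z ∈ resolventSetP A)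
    (hz' : z ∈ resolventSetP A') {ψ : Fin 2 → H} {c' : Fin 2 → Fin 2 → ℂ}
    (hψ : ∀ i, (ψ i, z • ψ i, Pi.single i 1, c' i) ∈ G) {φ : Fin 2 → H →L[ℂ] ℂ}
    (hφ : ∀ i j, φ i (ψ j) = if i = j then 1 else 0) {M : Matrix (Fin 2) (Fin 2) ℂ}
    (hM : ∀ f c c', (f, z • f, c, c') ∈ G → M.mulVec c = c') {h : H} {e : Fin 2 → ℂ}
    (he : (res A z h, h + z • res A z h, 0, e) ∈ G) :
    (res A' z - res A z) h = ∑ i, φ i ((res A' z - res A z) h) • ψ i ∧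
      e = -M.mulVec fun i => φ i ((res A' z - res A z) h) := by
  obtain ⟨d, hd⟩ := hG.graph_right.1 ((isResolvent_res hz').mem_graph h)
  set w := (res A' z - res A z) h with hw
  have h1 : (w, z • w, d, -e) ∈ G := by
    have := G.sub_mem hd he
    convert this using 1
    simp only [hw, Prod.mk_sub_mk, sub_zero, zero_sub, add_sub_add_left_eq_sub,
      sub_apply, smul_sub]
  have hsum := sum_mem hψ d
  have hd1 : ∑ i, d i • (Pi.single i 1 : Fin 2 → ℂ) = d := by
    funext j
    simp [Finset.sum_apply, Pi.single_apply]
  rw [hd1] at hsum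
  have h2 := G.sub_mem h1 hsum
  simp only [Prod.mk_sub_mk, sub_self, ← smul_sub] at h2
  have h3 : w = ∑ i, d i • ψ i :=
    sub_eq_zero.1 ((isResolvent_res hz).eq_zero_of_mem_graph (hG.graph_left.2 ⟨_, h2⟩))
  have h4 : ∀ i, φ i w = d i := by
    intro i
    rw [h3, map_sum]
    simp [hφ]
  refine ⟨?_, ?_⟩
  · simp only [h4]
    exact h3
  · simp only [h4]
    rw [hM _ _ _ h1, neg_neg]

/-- The trace formula for the resolvent difference of two boundary restrictions of a maximal
operator. -/
theorem trace_formula (hG : IsBoundaryRelation G A A') {Ω : Set ℂ}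
    (hΩ : ∀ z ∈ Ω, z ∈ resolventSetP A) (hΩ' : ∀ z ∈ Ω, z ∈ resolventSetP A')
    {Λ : ℂ → Matrix (Fin 2) (Fin 2) ℂ}
    (hΛ : ∀ z ∈ Ω, ∀ f c c', (f, z • f, c, c') ∈ G → (Λ z).mulVec c = c')
    (b : HilbertBasis ℕ ℂ H) {z : ℂ} (hz : z ∈ Ω) :
    IsTraceClass (res A' z - res A z) ∧
      (∃ Λd : Matrix (Fin 2) (Fin 2) ℂ,
        (∀ i j : Fin 2, HasDerivWithinAt (fun w => Λ w i j) (Λd i j) Ω z) ∧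
        traceH b (res A' z - res A z) = -Matrix.trace ((Λ z)⁻¹ * Λd)) ∧
      ∃ dd : ℂ, HasDerivWithinAt (fun w => (Λ w).det) dd Ω z ∧
        traceH b (res A' z - res A z) = -(dd / (Λ z).det) := by
  obtain ⟨ψ, c', hli, hψ⟩ := hG.exists_normalized (hΩ z hz)
  obtain ⟨φ, hφ⟩ := exists_biorthogonal hli
  have hR := isResolvent_res (hΩ z hz)
  have hR' := isResolvent_res (hΩ' z hz)
  have hdiff := fun h e => hG.resolvent_sub (h := h) (e := e) (hΩ z hz) (hΩ' z hz) hψ hφ (hΛ z hz)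
  let l : Fin 2 → H →L[ℂ] ℂ := fun i => (φ i).comp (res A' z - res A z)
  have hl : ∀ i h, l i h = φ i ((res A' z - res A z) h) := fun i h => rfl
  have hrank : ∀ h, (res A' z - res A z) h = ∑ i, l i h • ψ i := by
    intro h
    obtain ⟨e, he⟩ := hG.graph_left.1 (hR.mem_graph h)
    exact (hdiff h e he).1
  have htr := traceH_of_finite_rank b hrank
  have hcol : ∀ w ∈ Ω, ∀ i, (Λ w).mulVec (Pi.single i 1) = (Λ z).mulVec (Pi.single i 1) +
      (w - z) • -(Λ z).mulVec fun k => l k (ψ i + (w - z) • res A w (ψ i)) := by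
    intro w hw i
    have hg := (isResolvent_res (hΩ w hw)).mem_graph (ψ i)
    obtain ⟨e, he⟩ := hG.graph_left.1 hg
    have h1 := hR.eq_of_mem_graph hg
    set r := res A w (ψ i) with hr
    have h2 : res A z (ψ i + (w - z) • r) = r := by
      rw [← h1]
      congr 1
      rw [h1]
      module
    have h3 := hdiff (ψ i + (w - z) • r) e (by
      rw [h2]
      convert he using 2
      simp only [Prod.mk.injEq, and_true]
      module)
    have h4 : (ψ i + (w - z) • r, w • (ψ i + (w - z) • r), Pi.single i 1,
        c' i + (w - z) • e) ∈ G := by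
      have := G.add_mem (hψ i) (G.smul_mem (w - z) he)
      convert this using 1
      simp only [Prod.smul_mk, Prod.mk_add_mk, smul_zero, add_zero, Prod.mk.injEq, and_true,
        true_and]
      module
    rw [hΛ w hw _ _ _ h4, hΛ z hz _ _ _ (hψ i), h3.2]
    rfl
  have hentry : ∀ w ∈ Ω, ∀ i j, Λ w i j = Λ z i j +
      (w - z) * -(Λ z).mulVec (fun k => l k (ψ j + (w - z) • res A w (ψ j))) i := by
    intro w hw i j
    have := congrFun (hcol w hw j) i
    rw [Matrix.mulVec_single_one, Matrix.mulVec_single_one] at this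
    exact this
  let L : Matrix (Fin 2) (Fin 2) ℂ := Matrix.of fun k j => l k (ψ j)
  have hder : ∀ i j, HasDerivWithinAt (fun w => Λ w i j) ((-(Λ z * L)) i j) Ω z := by
    intro i j
    refine hasDerivWithinAt_of_eq_add_sub_mul (fun w hw => hentry w hw i j) ?_
    have hE : (-(Λ z * L)) i j = -(Λ z).mulVec (fun k => l k (ψ j)) i := by
      simp [Matrix.mul_apply, Matrix.mulVec, dotProduct, L]
    rw [hE]
    refine Tendsto.neg ?_
    simp only [Matrix.mulVec, dotProduct]
    refine tendsto_finsetSum _ fun k _ => Tendsto.const_mul _ ?_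
    exact ((l k).continuous.tendsto _).comp (tendsto_add_sub_smul_res hΩ (hΩ z hz) (ψ j))
  have hdet : (Λ z).det ≠ 0 := by
    intro h0
    obtain ⟨a, ha, ha0⟩ := Matrix.exists_mulVec_eq_zero_iff.2 h0
    have h1 := sum_mem hψ a
    have hd1 : ∑ i, a i • (Pi.single i 1 : Fin 2 → ℂ) = a := by
      funext j
      simp [Finset.sum_apply, Pi.single_apply]
    rw [hd1] at h1
    have h2 := hΛ z hz _ _ _ h1
    rw [ha0] at h2
    rw [← h2] at h1
    have h3 := hR'.eq_zero_of_mem_graph (hG.graph_right.2 ⟨_, h1⟩)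
    exact ha (funext (Fintype.linearIndependent_iff.1 hli a h3))
  have hLtr : L.trace = ∑ i, l i (ψ i) := rfl
  refine ⟨isTraceClass_of_finite_rank hrank, ⟨-(Λ z * L), hder, ?_⟩, ?_⟩
  · rw [htr, Matrix.mul_neg, Matrix.trace_neg, neg_neg,
      Matrix.nonsing_inv_mul_cancel_left _ _ (Ne.isUnit hdet), hLtr]
  · refine ⟨-((Λ z).det * L.trace), ?_, ?_⟩
    · have h := ((hder 0 0).mul (hder 1 1)).sub ((hder 0 1).mul (hder 1 0))
      have e : (fun w => (Λ w).det) = (fun w => Λ w 0 0) * (fun w => Λ w 1 1) -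
          (fun w => Λ w 0 1) * fun w => Λ w 1 0 := by
        funext w
        exact Matrix.det_fin_two _
      rw [e]
      refine h.congr_deriv ?_
      rw [Matrix.det_fin_two]
      simp only [Matrix.neg_apply, Matrix.mul_apply, Fin.sum_univ_two, Matrix.trace_fin_two]
      ring
    · rw [htr, hLtr]
      field_simp

end IsBoundaryRelation

end AbstractTrace

section Primitive

theorem absolutelyContinuousOnInterval_const {a b : ℝ} (c : ℂ) :
    AbsolutelyContinuousOnInterval (fun _ : ℝ => c) a b :=
  (LipschitzWith.const c).lipschitzOnWith.absolutelyContinuousOnInterval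

theorem absolutelyContinuousOnInterval_primitive {p : ℝ → ℂ} {a b : ℝ}
    (hp : IntervalIntegrable p volume a b) :
    AbsolutelyContinuousOnInterval (fun x => ∫ t in a..x, p t) a b := by
  have hre : IntervalIntegrable (fun x => (p x).re) volume a b := ⟨hp.1.re, hp.2.re⟩
  have him : IntervalIntegrable (fun x => (p x).im) volume a b := ⟨hp.1.im, hp.2.im⟩
  have h1 := hre.absolutelyContinuousOnInterval_intervalIntegral (c := a) (by simp)
  have h2 := him.absolutelyContinuousOnInterval_intervalIntegral (c := a) (by simp)
  have h := (h1.smul (absolutelyContinuousOnInterval_const 1)).add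
    (h2.smul (absolutelyContinuousOnInterval_const Complex.I))
  rw [absolutelyContinuousOnInterval_iff] at h ⊢
  have e : ∀ x ∈ Set.uIcc a b, ∫ t in a..x, p t =
      ((fun x : ℝ => ∫ t in a..x, (p t).re) • (fun _ : ℝ => (1 : ℂ)) +
        (fun x : ℝ => ∫ t in a..x, (p t).im) • (fun _ : ℝ => Complex.I) : ℝ → ℂ) x := by
    intro x hx
    have hpx : IntervalIntegrable p volume a x :=
      hp.mono_set (Set.uIcc_subset_uIcc Set.left_mem_uIcc hx)
    have e1 := Complex.reCLM.intervalIntegral_comp_comm hpx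
    have e2 := Complex.imCLM.intervalIntegral_comp_comm hpx
    simp only [Complex.reCLM_apply, Complex.imCLM_apply] at e1 e2
    simp only [Pi.add_apply, Pi.smul_apply', e1, e2]
    apply Complex.ext <;> simp
  intro ε hε
  obtain ⟨δ, hδ, H⟩ := h ε hε
  refine ⟨δ, hδ, fun E hE hEδ => ?_⟩
  convert H E hE hEδ using 1
  refine Finset.sum_congr rfl fun i hi => ?_
  rw [e _ (hE.1 i hi).1, e _ (hE.1 i hi).2]

/-- Product rule for primitives of integrable functions, in integrated form. -/
theorem integral_deriv_mul_primitive {p r F G : ℝ → ℂ} {a b : ℝ} (hab : a ≤ b)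
    (hp : IntervalIntegrable p volume a b) (hr : IntervalIntegrable r volume a b)
    (hF : ∀ x ∈ Set.Icc a b, F x = F a + ∫ t in a..x, p t)
    (hG : ∀ x ∈ Set.Icc a b, G x = G a + ∫ t in a..x, r t) :
    ∫ x in a..b, (p x * G x + F x * r x) = F b * G b - F a * G a := by
  set F' : ℝ → ℂ := fun x => F a + ∫ t in a..x, p t with hF'
  set G' : ℝ → ℂ := fun x => G a + ∫ t in a..x, r t with hG'
  have hF'ac : AbsolutelyContinuousOnInterval F' a b :=
    (absolutelyContinuousOnInterval_const (F a)).add (absolutelyContinuousOnInterval_primitive hp)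
  have hG'ac : AbsolutelyContinuousOnInterval G' a b :=
    (absolutelyContinuousOnInterval_const (G a)).add (absolutelyContinuousOnInterval_primitive hr)
  have h_int : IntervalIntegrable (fun x => p x * G' x + F' x * r x) volume a b :=
    (hp.mul_continuousOn hG'ac.continuousOn).add (hr.continuousOn_mul hF'ac.continuousOn)
  have hac : AbsolutelyContinuousOnInterval
      (F' • G' - fun x => ∫ t in a..x, (p t * G' t + F' t * r t)) a b :=
    (hF'ac.smul hG'ac).sub (absolutelyContinuousOnInterval_primitive h_int)
  obtain ⟨C, hC⟩ := hac.const_of_ae_hasDerivAt_zero (by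
    filter_upwards [hp.ae_hasDerivAt_integral, hr.ae_hasDerivAt_integral,
      h_int.ae_hasDerivAt_integral] with x h1 h2 h3 hx
    have d1 := (h1 hx a (by simp)).const_add (F a)
    have d2 := (h2 hx a (by simp)).const_add (G a)
    have d3 := h3 hx a (by simp)
    convert! (d1.mul d2).sub d3 using 1
    simp only [hF', hG']
    ring)
  have ha := hC a (by simp)
  have hb := hC b (by simp)
  have hbb := hF b ⟨hab, le_rfl⟩
  have hbb' := hG b ⟨hab, le_rfl⟩
  have hFa : F' a = F a := by simp [hF']
  have hGa : G' a = G a := by simp [hG']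
  have hFb : F' b = F b := hbb.symm
  have hGb : G' b = G b := hbb'.symm
  simp only [Pi.sub_apply, smul_eq_mul, Pi.mul_apply, intervalIntegral.integral_same, hFa, hGa,
    hFb, hGb, sub_zero] at ha hb
  have e : ∫ x in a..b, (p x * G x + F x * r x) = ∫ t in a..b, (p t * G' t + F' t * r t) := by
    refine intervalIntegral.integral_congr fun x hx => ?_
    rw [Set.uIcc_of_le hab] at hx
    simp only [hF', hG', ← hF x hx, ← hG x hx]
  rw [e]
  linear_combination ha - hb

/-- Fundamental theorem of calculus for a `C¹` function on a closed interval. -/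
theorem eq_add_integral_of_hasDerivWithinAt {g dg : ℝ → ℂ} {R : ℝ}
    (hg : ∀ x ∈ Set.Icc 0 R, HasDerivWithinAt g (dg x) (Set.Icc 0 R) x)
    (hdg : IntervalIntegrable dg volume 0 R) {x : ℝ} (hx : x ∈ Set.Icc 0 R) :
    g x = g 0 + ∫ t in (0 : ℝ)..x, dg t := by
  have hsub : Set.Icc 0 x ⊆ Set.Icc 0 R := Set.Icc_subset_Icc_right hx.2
  have := intervalIntegral.integral_eq_sub_of_hasDeriv_right (f := g) (f' := dg) (a := 0) (b := x)
    (by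
      rw [Set.uIcc_of_le hx.1]
      exact fun y hy => ((hg y (hsub hy)).continuousWithinAt).mono hsub)
    (by
      rw [min_eq_left hx.1, max_eq_right hx.1]
      intro y hy
      have hy' : y < R := hy.2.trans_le hx.2
      exact (hg y (hsub ⟨hy.1.le, hy.2.le⟩)).mono_of_mem_nhdsWithin
        (mem_nhdsWithin_of_mem_nhds (Icc_mem_nhds hy.1 hy')))
    (hdg.mono_set (by
      rw [Set.uIcc_of_le hx.1, Set.uIcc_of_le (hx.1.trans hx.2)]
      exact hsub))
  rw [this]; ring

end Primitive

section Existence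

/-- Solvability of the Volterra equation `u x = a + b x + ∫₀ˣ (x - t) q t u t dt`. -/
theorem exists_volterra {R : ℝ} (hR : 0 < R) {q : ℝ → ℂ} (hq : Integrable q) (a b : ℂ) :
    ∃ u : ℝ → ℂ, Continuous u ∧ ∀ x ∈ Set.Icc 0 R,
      u x = a + b * x + ∫ t in (0 : ℝ)..x, ((x : ℂ) - t) * (q t * u t) := by
  set k : ℝ := 2 * (∫ t, ‖q t‖) + 1 with hk
  have hq0 : 0 ≤ ∫ t, ‖q t‖ := integral_nonneg fun _ => norm_nonneg _
  have hkpos : 0 < k := by linarith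
  have hR' : (0 : ℝ) ≤ R := hR.le
  let ext : C(Set.Icc (0 : ℝ) R, ℂ) → ℝ → ℂ := fun v => Set.IccExtend hR' v
  have hext : ∀ v, Continuous (ext v) := fun v => v.continuous.Icc_extend'
  have hextb : ∀ v w t, ‖ext v t - ext w t‖ ≤ dist v w := fun v w t => by
    rw [← dist_eq_norm]
    exact ContinuousMap.dist_apply_le_dist _
  have hqi : ∀ (f : ℝ → ℂ), Continuous f → ∀ a b,
      IntervalIntegrable (fun t => f t * q t) volume a b :=
    fun f hf a b => hq.intervalIntegrable.continuousOn_mul hf.continuousOn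
  let Φ : C(Set.Icc (0 : ℝ) R, ℂ) → ℝ → ℂ := fun v x => Complex.exp (-k * x) * (a + b * x) +
    Complex.exp (-k * x) * (x * (∫ t in (0 : ℝ)..x, (Complex.exp (k * t) * ext v t) * q t) -
      ∫ t in (0 : ℝ)..x, (t * Complex.exp (k * t) * ext v t) * q t)
  have hΦc : ∀ v, Continuous (Φ v) := by
    intro v
    have h1 := intervalIntegral.continuous_primitive (μ := volume)
      (hqi (fun t => Complex.exp (k * t) * ext v t) (by have := hext v; fun_prop)) 0
    have h2 := intervalIntegral.continuous_primitive (μ := volume)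
      (hqi (fun t => t * Complex.exp (k * t) * ext v t) (by have := hext v; fun_prop)) 0
    fun_prop
  have hΦ : ∀ v x, Φ v x = Complex.exp (-k * x) * (a + b * x) + ∫ t in (0 : ℝ)..x,
      (Complex.exp (-k * (x - t)) * (x - t) * ext v t) * q t := by
    intro v x
    have hc := hext v
    simp only [Φ]
    rw [← intervalIntegral.integral_const_mul, ← intervalIntegral.integral_sub,
      ← intervalIntegral.integral_const_mul]
    · congr 1
      refine intervalIntegral.integral_congr fun t _ => ?_
      rw [show (-k * ((x : ℂ) - t)) = -k * x + k * t by ring, Complex.exp_add]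
      ring
    · exact (hqi (fun t => Complex.exp (k * t) * ext v t) (by fun_prop) 0 x).const_mul _
    · exact hqi (fun t => t * Complex.exp (k * t) * ext v t) (by fun_prop) 0 x
  let T : C(Set.Icc (0 : ℝ) R, ℂ) → C(Set.Icc (0 : ℝ) R, ℂ) := fun v =>
    ⟨fun x => Φ v x, (hΦc v).comp continuous_subtype_val⟩
  have hker : ∀ s : ℝ, 0 ≤ s → Real.exp (-k * s) * s ≤ 1 / k := by
    intro s hs
    have h1 : k * s ≤ Real.exp (k * s) := by linarith [Real.add_one_le_exp (k * s)]
    rw [le_div_iff₀ hkpos, neg_mul, Real.exp_neg]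
    have h2 := Real.exp_pos (k * s)
    rw [mul_assoc, inv_mul_le_iff₀ h2]
    linarith
  have hT : ContractingWith (1 / 2) T := by
    refine ⟨by rw [← NNReal.coe_lt_coe]; norm_num, LipschitzWith.of_dist_le_mul fun v w => ?_⟩
    rw [ContinuousMap.dist_le (by positivity)]
    rintro ⟨x, hx⟩
    have h_int : ∀ v, IntervalIntegrable (fun t : ℝ =>
        (Complex.exp (-k * (x - t)) * (x - t) * ext v t) * q t) volume 0 x := fun v =>
      hqi (fun t : ℝ => Complex.exp (-k * (x - t)) * (x - t) * ext v t)
        (by have := hext v; fun_prop) 0 x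
    change dist (Φ v x) (Φ w x) ≤ _
    rw [dist_eq_norm, hΦ, hΦ, add_sub_add_left_eq_sub,
      ← intervalIntegral.integral_sub (h_int v) (h_int w)]
    calc ‖∫ t in (0 : ℝ)..x, ((Complex.exp (-k * (x - t)) * (x - t) * ext v t) * q t -
            (Complex.exp (-k * (x - t)) * (x - t) * ext w t) * q t)‖
        ≤ ∫ t in (0 : ℝ)..x, 1 / k * dist v w * ‖q t‖ := by
          refine intervalIntegral.norm_integral_le_of_norm_le hx.1 (ae_of_all _ fun t ht => ?_)
            (hq.norm.const_mul _).intervalIntegrable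
          have hxt : 0 ≤ x - t := by linarith [ht.2]
          have e : (Complex.exp (-k * (x - t)) * (x - t) * ext v t) * q t -
              (Complex.exp (-k * (x - t)) * (x - t) * ext w t) * q t =
              ((Real.exp (-k * (x - t)) * (x - t) : ℝ) : ℂ) * (ext v t - ext w t) * q t := by
            push_cast; ring
          rw [e, norm_mul, norm_mul, Complex.norm_real, Real.norm_of_nonneg (by positivity)]
          have := hker _ hxt
          have := hextb v w t
          gcongr
      _ = 1 / k * dist v w * ∫ t in (0 : ℝ)..x, ‖q t‖ := intervalIntegral.integral_const_mul _ _
      _ ≤ 1 / k * dist v w * ∫ t, ‖q t‖ := by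
          gcongr
          rw [intervalIntegral.integral_of_le hx.1]
          exact setIntegral_le_integral hq.norm (ae_of_all _ fun _ => norm_nonneg _)
      _ ≤ _ := by
          have h1 : 1 / k * ∫ t, ‖q t‖ ≤ 1 / 2 := by
            rw [div_mul_eq_mul_div, div_le_div_iff₀ hkpos two_pos]
            linarith
          have h2 : 0 ≤ dist v w := dist_nonneg
          calc 1 / k * dist v w * ∫ t, ‖q t‖ = (1 / k * ∫ t, ‖q t‖) * dist v w := by ring
            _ ≤ 1 / 2 * dist v w := by gcongr
            _ = _ := by push_cast; rfl
  obtain ⟨v, hv⟩ : ∃ v, T v = v := ⟨_, hT.fixedPoint_isFixedPt⟩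
  refine ⟨fun x => Complex.exp (k * x) * ext v x, by have := hext v; fun_prop, fun x hx => ?_⟩
  have h1 : ext v x = Φ v x := by
    have h2 : ext v x = v ⟨x, hx⟩ := Set.IccExtend_of_mem hR' v hx
    rw [h2]
    conv_lhs => rw [← hv]
    rfl
  change Complex.exp (k * x) * ext v x = _
  rw [h1, hΦ, mul_add, ← mul_assoc, ← Complex.exp_add, ← intervalIntegral.integral_const_mul]
  congr 1
  · simp
  · refine intervalIntegral.integral_congr fun t _ => ?_
    rw [show (-k * ((x : ℂ) - t)) = -(k * x) + k * t by ring, Complex.exp_add, Complex.exp_neg]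
    field_simp [Complex.exp_ne_zero]

/-- Existence for the initial value problem with an integrable potential. -/
theorem exists_solODE {R : ℝ} (hR : 0 < R) {V : ℝ → ℂ} (hV : IntervalIntegrable V volume 0 R)
    (z a b : ℂ) : ∃ u du : ℝ → ℂ, SolODE R V z u du ∧ u 0 = a ∧ du 0 = b := by
  have hVz : IntervalIntegrable (fun t => V t - z) volume 0 R :=
    hV.sub intervalIntegrable_const
  have hVz' : IntegrableOn (fun t => V t - z) (Set.Ioc 0 R) volume :=
    (intervalIntegrable_iff_integrableOn_Ioc_of_le hR.le).1 hVz
  set q : ℝ → ℂ := Set.indicator (Set.Ioc 0 R) fun t => V t - z with hqdef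
  have hq : Integrable q := (integrable_indicator_iff measurableSet_Ioc).2 hVz'
  obtain ⟨u, hu, hueq⟩ := exists_volterra hR hq a b
  have hqu : ∀ c d, IntervalIntegrable (fun t => q t * u t) volume c d := fun c d =>
    hq.intervalIntegrable.mul_continuousOn hu.continuousOn
  set P : ℝ → ℂ := fun x => ∫ t in (0 : ℝ)..x, q t * u t with hP
  have hPc : Continuous P := intervalIntegral.continuous_primitive (hqu · ·) 0
  have hu' : ∀ x ∈ Set.Icc 0 R, u x = a + b * x + ∫ t in (0 : ℝ)..x, P t := by
    intro x hx
    rw [hueq x hx]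
    congr 1
    have h := integral_deriv_mul_primitive (a := 0) (b := x) (F := P)
      (G := fun t : ℝ => (x : ℂ) - t) (p := fun t => q t * u t) (r := fun _ => -1) hx.1 (hqu 0 x) intervalIntegrable_const
      (fun y _ => by simp [hP]) (fun y _ => by simp; ring)
    have hP0 : P 0 = 0 := by simp [hP]
    have h' : ∫ t in (0 : ℝ)..x, (q t * u t * ((x : ℂ) - t) + P t * -1) =
        (∫ t in (0 : ℝ)..x, q t * u t * ((x : ℂ) - t)) + ∫ t in (0 : ℝ)..x, P t * -1 :=
      intervalIntegral.integral_add
        ((hqu 0 x).mul_continuousOn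
          (by fun_prop : Continuous fun t : ℝ => (x : ℂ) - t).continuousOn)
        ((hPc.mul continuous_const).intervalIntegrable _ _)
    rw [h'] at h
    simp only [hP0, mul_neg, mul_one, intervalIntegral.integral_neg, sub_self, mul_zero,
      zero_mul] at h
    rw [← sub_eq_zero, sub_eq_add_neg, ← h]
    congr 1
    exact intervalIntegral.integral_congr fun t _ => mul_comm _ _
  refine ⟨u, fun x => b + P x, ⟨fun x hx => ?_, fun x hx => ?_⟩, ?_, ?_⟩
  · have h1 : HasDerivAt (fun y : ℝ => a + b * y + ∫ t in (0 : ℝ)..y, P t) (b + P x) x := by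
      have h2 : HasDerivAt (fun y : ℝ => a + b * (y : ℂ)) b x := by
        simpa using ((Complex.ofRealCLM.hasDerivAt (x := x)).const_mul b).const_add a
      exact h2.add (hPc.integral_hasStrictDerivAt 0 x).hasDerivAt
    exact h1.hasDerivWithinAt.congr hu' (hu' x hx)
  · have hP0 : P 0 = 0 := by simp [hP]
    simp only [hP0, add_zero]
    congr 1
    refine intervalIntegral.integral_congr_ae (ae_of_all _ fun t ht => ?_)
    rw [Set.uIoc_of_le hx.1] at ht
    have : t ∈ Set.Ioc 0 R := ⟨ht.1, ht.2.trans hx.2⟩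
    rw [hqdef, Set.indicator_of_mem this]
  · rw [hu' 0 ⟨le_rfl, hR.le⟩]; simp
  · simp [hP]

end Existence

section BoundaryTraces

theorem bdryC_add (R : ℝ) (t0 tR : ℂ) (u du v dv : ℝ → ℂ) :
    bdryC R t0 tR (u + v) (du + dv) = bdryC R t0 tR u du + bdryC R t0 tR v dv := by
  ext i
  fin_cases i <;> simp [bdryC] <;> ring

theorem bdryC_smul (R : ℝ) (t0 tR c : ℂ) (u du : ℝ → ℂ) :
    bdryC R t0 tR (c • u) (c • du) = c • bdryC R t0 tR u du := by
  ext i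
  fin_cases i <;> simp [bdryC] <;> ring

theorem bdryC_eq_zero {R : ℝ} (hR : 0 ≤ R) (t0 tR : ℂ) {u du : ℝ → ℂ}
    (h : ∀ x ∈ Set.Icc 0 R, u x = 0 ∧ du x = 0) : bdryC R t0 tR u du = 0 := by
  obtain ⟨h0, h0'⟩ := h 0 ⟨le_rfl, hR⟩
  obtain ⟨h1, h1'⟩ := h R ⟨hR, le_rfl⟩
  ext i
  fin_cases i <;> simp [bdryC, h0, h0', h1, h1']

variable {R : ℝ} {V : ℝ → ℂ}

theorem intervalIntegrable_of_coeFn_ae_eq (hR : 0 ≤ R) (h : SchSp R) {h0 : ℝ → ℂ}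
    (hh : ∀ᵐ x ∂(volume.restrict (Set.Ioo (0 : ℝ) R)), h x = h0 x) :
    IntervalIntegrable h0 volume 0 R := by
  rw [intervalIntegrable_iff_integrableOn_Ioo_of_le hR]
  exact ((Lp.memLp h).integrable (by norm_num)).congr hh

theorem continuousOn_of_hasDerivWithinAt_Icc {g dg : ℝ → ℂ}
    (hg : ∀ x ∈ Set.Icc 0 R, HasDerivWithinAt g (dg x) (Set.Icc 0 R) x) :
    ContinuousOn g (Set.Icc 0 R) := fun x hx => (hg x hx).continuousWithinAt

theorem intervalIntegrable_rhs (hR : 0 ≤ R) (hV : IntervalIntegrable V volume 0 R) (z : ℂ)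
    {h : SchSp R} {g h0 : ℝ → ℂ} (hg : ContinuousOn g (Set.Icc 0 R))
    (hh : ∀ᵐ x ∂(volume.restrict (Set.Ioo (0 : ℝ) R)), h x = h0 x) :
    IntervalIntegrable (fun t => V t * g t - z * g t - h0 t) volume 0 R := by
  rw [← Set.uIcc_of_le hR] at hg
  exact ((hV.mul_continuousOn hg).sub (hg.intervalIntegrable.const_mul z)).sub
    (intervalIntegrable_of_coeFn_ae_eq hR h hh)

theorem IntervalIntegrable.mono_Icc {E : Type*} [NormedAddCommGroup E] {p : ℝ → E}
    (hp : IntervalIntegrable p volume 0 R) {x : ℝ} (hx : x ∈ Set.Icc 0 R) :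
    IntervalIntegrable p volume 0 x :=
  hp.mono_set (Set.uIcc_subset_uIcc Set.left_mem_uIcc
    (by rwa [Set.uIcc_of_le (hx.1.trans hx.2)]))

theorem SolvesAt.zero (z : ℂ) : SolvesAt R V z 0 0 0 0 := by
  have h0 := Lp.coeFn_zero ℂ 2 (volume.restrict (Set.Ioo (0 : ℝ) R))
  refine ⟨h0, fun x _ => hasDerivWithinAt_const _ _ _, 0, h0, fun x _ => ?_⟩
  simp

theorem SolvesAt.add (hV : IntervalIntegrable V volume 0 R) {z : ℂ}
    {f h f' h' : SchSp R} {g dg g' dg' : ℝ → ℂ} (H₁ : SolvesAt R V z f h g dg)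
    (H₂ : SolvesAt R V z f' h' g' dg') :
    SolvesAt R V z (f + f') (h + h') (g + g') (dg + dg') := by
  obtain ⟨hf, hg, h0, hh, hd⟩ := H₁
  obtain ⟨hf', hg', h0', hh', hd'⟩ := H₂
  refine ⟨?_, fun x hx => (hg x hx).add (hg' x hx), h0 + h0', ?_, fun x hx => ?_⟩
  · filter_upwards [hf, hf', Lp.coeFn_add f f'] with x h1 h2 h3
    rw [h3, Pi.add_apply, Pi.add_apply, h1, h2]
  · filter_upwards [hh, hh', Lp.coeFn_add h h'] with x h1 h2 h3
    rw [h3, Pi.add_apply, Pi.add_apply, h1, h2]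
  · have hR : 0 ≤ R := hx.1.trans hx.2
    have i1 := (intervalIntegrable_rhs hR hV z
      (continuousOn_of_hasDerivWithinAt_Icc hg) hh).mono_Icc hx
    have i2 := (intervalIntegrable_rhs hR hV z
      (continuousOn_of_hasDerivWithinAt_Icc hg') hh').mono_Icc hx
    simp only [Pi.add_apply]
    rw [hd x hx, hd' x hx, add_add_add_comm, ← intervalIntegral.integral_add i1 i2]
    congr 1
    exact intervalIntegral.integral_congr fun t _ => by ring

theorem SolvesAt.smul (c : ℂ) {z : ℂ} {f h : SchSp R} {g dg : ℝ → ℂ}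
    (H : SolvesAt R V z f h g dg) : SolvesAt R V z (c • f) (c • h) (c • g) (c • dg) := by
  obtain ⟨hf, hg, h0, hh, hd⟩ := H
  refine ⟨?_, fun x hx => (hg x hx).const_smul c, c • h0, ?_, fun x hx => ?_⟩
  · filter_upwards [hf, Lp.coeFn_smul c f] with x h1 h2
    rw [h2, Pi.smul_apply, Pi.smul_apply, h1]
  · filter_upwards [hh, Lp.coeFn_smul c h] with x h1 h2
    rw [h2, Pi.smul_apply, Pi.smul_apply, h1]
  · simp only [Pi.smul_apply, smul_eq_mul]
    rw [hd x hx, mul_add, ← intervalIntegral.integral_const_mul]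
    congr 1
    exact intervalIntegral.integral_congr fun t _ => by ring

/-- The representative of `f` is determined by `f`; in particular it vanishes with `f`. -/
theorem SolvesAt.eq_zero (hR : 0 < R) {z : ℂ} {h : SchSp R} {g dg : ℝ → ℂ}
    (H : SolvesAt R V z 0 h g dg) : ∀ x ∈ Set.Icc 0 R, g x = 0 ∧ dg x = 0 := by
  obtain ⟨hf, hg, -⟩ := H
  have hg0 : Set.EqOn g (fun _ => 0) (Set.Icc 0 R) := by
    refine Measure.eqOn_Icc_of_ae_eq volume hR.ne ?_
      (continuousOn_of_hasDerivWithinAt_Icc hg) continuousOn_const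
    rw [← Measure.restrict_congr_set Ioo_ae_eq_Icc]
    filter_upwards [hf, Lp.coeFn_zero ℂ 2 (volume.restrict (Set.Ioo (0 : ℝ) R))] with x h1 h2
    rw [← h1, h2, Pi.zero_apply]
  refine fun x hx => ⟨hg0 hx, ?_⟩
  have h2 : HasDerivWithinAt g 0 (Set.Icc 0 R) x :=
    (hasDerivWithinAt_const x _ (0 : ℂ)).congr hg0 (hg0 hx)
  exact (uniqueDiffOn_Icc hR x hx).eq_deriv _ (hg x hx) h2

theorem SolvesAt.solODE {z : ℂ} {f : SchSp R} {g dg : ℝ → ℂ}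
    (H : SolvesAt R V 0 f (z • f) g dg) : SolODE R V z g dg := by
  obtain ⟨hf, hg, h0, hh, hd⟩ := H
  refine ⟨hg, fun x hx => ?_⟩
  rw [hd x hx]
  congr 1
  refine intervalIntegral.integral_congr_ae ?_
  have e : ∀ᵐ x ∂(volume.restrict (Set.Ioo (0 : ℝ) R)), h0 x = z * g x := by
    filter_upwards [hf, hh, Lp.coeFn_smul z f] with x h1 h2 h3
    rw [← h2, h3, Pi.smul_apply, h1, smul_eq_mul]
  rw [Measure.restrict_congr_set Ioo_ae_eq_Ioc, ae_restrict_iff' measurableSet_Ioc] at e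
  filter_upwards [e] with t ht htx
  rw [Set.uIoc_of_le hx.1] at htx
  rw [ht ⟨htx.1, htx.2.trans hx.2⟩]
  ring

theorem SolODE.exists_solvesAt {z : ℂ} {u du : ℝ → ℂ} (H : SolODE R V z u du) :
    ∃ f : SchSp R, SolvesAt R V 0 f (z • f) u du := by
  obtain ⟨hu, hd⟩ := H
  have hc := continuousOn_of_hasDerivWithinAt_Icc hu
  obtain ⟨C, hC⟩ := isCompact_Icc.exists_bound_of_continuousOn hc
  have hm : MemLp u 2 (volume.restrict (Set.Ioo (0 : ℝ) R)) := by
    refine MemLp.of_bound ((hc.mono Set.Ioo_subset_Icc_self).aestronglyMeasurable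
      measurableSet_Ioo) C ?_
    filter_upwards [ae_restrict_mem measurableSet_Ioo] with x hx
    exact hC x (Set.Ioo_subset_Icc_self hx)
  refine ⟨hm.toLp u, hm.coeFn_toLp, hu, fun x => z * u x, ?_, fun x hx => ?_⟩
  · filter_upwards [hm.coeFn_toLp, Lp.coeFn_smul z (hm.toLp u)] with x h1 h2
    rw [h2, Pi.smul_apply, h1, smul_eq_mul]
  · rw [hd x hx]
    congr 1
    exact intervalIntegral.integral_congr fun t _ => by ring

/-- The joint graph of the maximal operator `-d²/dx² + V` and of two pairs of boundary traces. -/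
def boundaryRelation (hV : IntervalIntegrable V volume 0 R) (t0 tR t0' tR' : ℂ) :
    Submodule ℂ (SchSp R × SchSp R × (Fin 2 → ℂ) × (Fin 2 → ℂ)) where
  carrier := {p | ∃ g dg : ℝ → ℂ, SolvesAt R V 0 p.1 p.2.1 g dg ∧
    bdryC R t0 tR g dg = p.2.2.1 ∧ bdryC R t0' tR' g dg = p.2.2.2}
  zero_mem' := ⟨0, 0, SolvesAt.zero 0, by
    simp [bdryC], by simp [bdryC]⟩
  add_mem' := by
    rintro p q ⟨g, dg, h, h1, h2⟩ ⟨g', dg', h', h1', h2'⟩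
    exact ⟨g + g', dg + dg', h.add hV h', by rw [bdryC_add, h1, h1']; rfl,
      by rw [bdryC_add, h2, h2']; rfl⟩
  smul_mem' := by
    rintro c p ⟨g, dg, h, h1, h2⟩
    exact ⟨c • g, c • dg, h.smul c, by rw [bdryC_smul, h1]; rfl, by rw [bdryC_smul, h2]; rfl⟩

theorem isBoundaryRelation_boundaryRelation (hR : 0 < R) (hV : IntervalIntegrable V volume 0 R)
    {t0 tR t0' tR' : ℂ} {A A' : SchSp R →ₗ.[ℂ] SchSp R} (hA : IsSchrodingerOp R V t0 tR A)
    (hA' : IsSchrodingerOp R V t0' tR' A') :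
    IsBoundaryRelation (boundaryRelation hV t0 tR t0' tR') A A' where
  trace_zero := by
    rintro c c' ⟨g, dg, h, h1, h2⟩
    have h0 := h.eq_zero hR
    exact ⟨h1.symm.trans (bdryC_eq_zero hR.le t0 tR h0),
      h2.symm.trans (bdryC_eq_zero hR.le t0' tR' h0)⟩
  graph_left := fun {f h} => (hA f h).trans
    ⟨fun ⟨g, dg, H, h0⟩ => ⟨_, g, dg, H, h0, rfl⟩, fun ⟨_, g, dg, H, h0, _⟩ => ⟨g, dg, H, h0⟩⟩
  graph_right := fun {f h} => (hA' f h).trans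
    ⟨fun ⟨g, dg, H, h0⟩ => ⟨_, g, dg, H, rfl, h0⟩, fun ⟨_, g, dg, H, _, h0⟩ => ⟨g, dg, H, h0⟩⟩
  exists_sol := by
    intro z
    obtain ⟨u, du, hu, hu0, hdu0⟩ := exists_solODE hR hV z 1 0
    obtain ⟨v, dv, hv, hv0, hdv0⟩ := exists_solODE hR hV z 0 1
    obtain ⟨f, hf⟩ := hu.exists_solvesAt
    obtain ⟨f', hf'⟩ := hv.exists_solvesAt
    refine ⟨![f, f'], ![bdryC R t0 tR u du, bdryC R t0 tR v dv],
      ![bdryC R t0' tR' u du, bdryC R t0' tR' v dv], ?_, ?_⟩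
    · rw [LinearIndependent.pair_iff]
      intro s t hst
      have h := (hf.smul s).add hV (hf'.smul t)
      rw [hst] at h
      obtain ⟨h1, h2⟩ := h.eq_zero hR 0 ⟨le_rfl, hR.le⟩
      simpa [hu0, hv0, hdu0, hdv0] using And.intro h1 h2
    · intro i
      fin_cases i
      · exact ⟨u, du, hf, rfl, rfl⟩
      · exact ⟨v, dv, hf', rfl, rfl⟩

end BoundaryTraces

section Semibounded

theorem exists_norm_mul_conj_le_of_cos_sin (θ : ℝ) : ∃ c : ℝ, 0 ≤ c ∧ ∀ a b : ℂ,
    Complex.cos θ * a + Complex.sin θ * b = 0 → ‖b * starRingEnd ℂ a‖ ≤ c * ‖a‖ ^ 2 := by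
  by_cases hs : Complex.sin θ = 0
  · refine ⟨0, le_rfl, fun a b h => ?_⟩
    have hc : Complex.cos θ ≠ 0 := fun hc => by
      have := Complex.sin_sq_add_cos_sq (θ : ℂ)
      simp [hs, hc] at this
    have ha : a = 0 := by simpa [hs, hc] using h
    simp [ha]
  · refine ⟨‖Complex.cos θ / Complex.sin θ‖, norm_nonneg _, fun a b h => ?_⟩
    have hb : b = -(Complex.cos θ / Complex.sin θ) * a := by
      field_simp
      linear_combination h
    rw [hb]
    simp only [norm_mul, norm_neg, RCLike.norm_conj]
    exact le_of_eq (by ring)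

variable {R : ℝ} {g dg : ℝ → ℂ}

theorem conj_eq_add_integral
    (hg : ∀ x ∈ Set.Icc 0 R, HasDerivWithinAt g (dg x) (Set.Icc 0 R) x)
    (hdg : ContinuousOn dg (Set.Icc 0 R)) {x : ℝ} (hx : x ∈ Set.Icc 0 R) :
    starRingEnd ℂ (g x) = starRingEnd ℂ (g 0) + ∫ t in (0 : ℝ)..x, starRingEnd ℂ (dg t) := by
  refine eq_add_integral_of_hasDerivWithinAt (g := fun x => starRingEnd ℂ (g x))
    (dg := fun x => starRingEnd ℂ (dg x)) (fun y hy => (hg y hy).star) ?_ hx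
  refine ContinuousOn.intervalIntegrable ?_
  rw [Set.uIcc_of_le (hx.1.trans hx.2)]
  exact Complex.continuous_conj.comp_continuousOn hdg

theorem norm_sq_sub_norm_sq_le
    (hg : ∀ x ∈ Set.Icc 0 R, HasDerivWithinAt g (dg x) (Set.Icc 0 R) x)
    (hdg : ContinuousOn dg (Set.Icc 0 R)) {ε : ℝ} (hε : 0 < ε) {s t : ℝ}
    (hs : s ∈ Set.Icc 0 R) (ht : t ∈ Set.Icc 0 R) :
    ‖g s‖ ^ 2 - ‖g t‖ ^ 2 ≤ ∫ x in (0 : ℝ)..R, (ε * ‖dg x‖ ^ 2 + 1 / ε * ‖g x‖ ^ 2) := by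
  have hR : 0 ≤ R := hs.1.trans hs.2
  have hgc := continuousOn_of_hasDerivWithinAt_Icc hg
  have hpc : ContinuousOn (fun x => dg x * starRingEnd ℂ (g x) + g x * starRingEnd ℂ (dg x))
      (Set.Icc 0 R) := by fun_prop
  have hwc : ContinuousOn (fun x => ε * ‖dg x‖ ^ 2 + 1 / ε * ‖g x‖ ^ 2) (Set.Icc 0 R) := by
    fun_prop
  have hp : IntervalIntegrable
      (fun x => dg x * starRingEnd ℂ (g x) + g x * starRingEnd ℂ (dg x)) volume 0 R :=
    ContinuousOn.intervalIntegrable (by rwa [Set.uIcc_of_le hR])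
  have hw : IntervalIntegrable (fun x => ε * ‖dg x‖ ^ 2 + 1 / ε * ‖g x‖ ^ 2) volume 0 R :=
    ContinuousOn.intervalIntegrable (by rwa [Set.uIcc_of_le hR])
  have hdgi : IntervalIntegrable dg volume 0 R :=
    ContinuousOn.intervalIntegrable (by rwa [Set.uIcc_of_le hR])
  have hdgi' : IntervalIntegrable (fun x => starRingEnd ℂ (dg x)) volume 0 R :=
    ContinuousOn.intervalIntegrable (by
      rw [Set.uIcc_of_le hR]
      exact Complex.continuous_conj.comp_continuousOn hdg)
  have key : ∀ y ∈ Set.Icc 0 R,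
      ∫ x in (0 : ℝ)..y, (dg x * starRingEnd ℂ (g x) + g x * starRingEnd ℂ (dg x)) =
        ((‖g y‖ ^ 2 - ‖g 0‖ ^ 2 : ℝ) : ℂ) := by
    intro y hy
    have hsub : Set.Icc 0 y ⊆ Set.Icc 0 R := Set.Icc_subset_Icc_right hy.2
    rw [integral_deriv_mul_primitive (G := fun x => starRingEnd ℂ (g x)) hy.1
      (hdgi.mono_Icc hy) (hdgi'.mono_Icc hy)
      (fun x hx => eq_add_integral_of_hasDerivWithinAt hg hdgi (hsub hx))
      (fun x hx => conj_eq_add_integral hg hdg (hsub hx))]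
    simp only [Complex.mul_conj, Complex.normSq_eq_norm_sq]
    push_cast
    ring
  have hpt : ∀ x, ‖dg x * starRingEnd ℂ (g x) + g x * starRingEnd ℂ (dg x)‖ ≤
      ε * ‖dg x‖ ^ 2 + 1 / ε * ‖g x‖ ^ 2 := by
    intro x
    refine (norm_add_le _ _).trans ?_
    simp only [norm_mul, RCLike.norm_conj]
    have h1 : 0 ≤ (ε * ‖dg x‖ - ‖g x‖) ^ 2 / ε := by positivity
    have h2 : (ε * ‖dg x‖ - ‖g x‖) ^ 2 / ε =
        ε * ‖dg x‖ ^ 2 + 1 / ε * ‖g x‖ ^ 2 - 2 * (‖dg x‖ * ‖g x‖) := by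
      field_simp
      ring
    linarith
  have main : ∀ a ∈ Set.Icc 0 R, ∀ c ∈ Set.Icc 0 R, a ≤ c →
      |‖g c‖ ^ 2 - ‖g a‖ ^ 2| ≤ ∫ x in (0 : ℝ)..R, (ε * ‖dg x‖ ^ 2 + 1 / ε * ‖g x‖ ^ 2) := by
    intro a ha c hc hac
    have e : ((‖g c‖ ^ 2 - ‖g a‖ ^ 2 : ℝ) : ℂ) =
        ∫ x in a..c, (dg x * starRingEnd ℂ (g x) + g x * starRingEnd ℂ (dg x)) := by
      rw [← intervalIntegral.integral_interval_sub_left (hp.mono_Icc hc) (hp.mono_Icc ha),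
        key c hc, key a ha]
      push_cast
      ring
    rw [← Real.norm_eq_abs, ← Complex.norm_real, e]
    have hwac : IntervalIntegrable (fun x => ε * ‖dg x‖ ^ 2 + 1 / ε * ‖g x‖ ^ 2) volume a c :=
      hw.mono_set (by
        rw [Set.uIcc_of_le hac, Set.uIcc_of_le hR]
        exact Set.Icc_subset_Icc ha.1 hc.2)
    refine (intervalIntegral.norm_integral_le_of_norm_le hac
      (ae_of_all _ fun x _ => hpt x) hwac).trans ?_
    exact intervalIntegral.integral_mono_interval ha.1 hac hc.2
      (ae_of_all _ fun x => (norm_nonneg _).trans (hpt x)) hw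
  rcases le_total t s with h | h
  · exact (le_abs_self _).trans (main t ht s hs h)
  · rw [← neg_sub]
    exact (neg_le_abs _).trans (main s hs t ht h)

/-- A Sobolev inequality on a bounded interval. -/
theorem norm_sq_le_of_hasDerivWithinAt (hR : 0 < R)
    (hg : ∀ x ∈ Set.Icc 0 R, HasDerivWithinAt g (dg x) (Set.Icc 0 R) x)
    (hdg : ContinuousOn dg (Set.Icc 0 R)) {ε : ℝ} (hε : 0 < ε) {s : ℝ} (hs : s ∈ Set.Icc 0 R) :
    ‖g s‖ ^ 2 ≤ (1 / R + 1 / ε) * (∫ x in (0 : ℝ)..R, ‖g x‖ ^ 2) +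
      ε * ∫ x in (0 : ℝ)..R, ‖dg x‖ ^ 2 := by
  have hgc := continuousOn_of_hasDerivWithinAt_Icc hg
  have hgi : IntervalIntegrable (fun x => ‖g x‖ ^ 2) volume 0 R :=
    ContinuousOn.intervalIntegrable (by rw [Set.uIcc_of_le hR.le]; fun_prop)
  have hdgi : IntervalIntegrable (fun x => ‖dg x‖ ^ 2) volume 0 R :=
    ContinuousOn.intervalIntegrable (by rw [Set.uIcc_of_le hR.le]; fun_prop)
  set W := ∫ x in (0 : ℝ)..R, (ε * ‖dg x‖ ^ 2 + 1 / ε * ‖g x‖ ^ 2) with hW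
  have hWe : W = ε * (∫ x in (0 : ℝ)..R, ‖dg x‖ ^ 2) + 1 / ε * ∫ x in (0 : ℝ)..R, ‖g x‖ ^ 2 := by
    rw [hW, intervalIntegral.integral_add (hdgi.const_mul _) (hgi.const_mul _),
      intervalIntegral.integral_const_mul, intervalIntegral.integral_const_mul]
  have h1 : ∫ _ in (0 : ℝ)..R, ‖g s‖ ^ 2 ≤ ∫ x in (0 : ℝ)..R, (‖g x‖ ^ 2 + W) :=
    intervalIntegral.integral_mono_on hR.le intervalIntegrable_const
      (hgi.add intervalIntegrable_const) fun x hx => by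
        linarith [norm_sq_sub_norm_sq_le hg hdg hε hs hx]
  rw [intervalIntegral.integral_add hgi intervalIntegrable_const,
    intervalIntegral.integral_const, intervalIntegral.integral_const] at h1
  simp only [sub_zero, smul_eq_mul] at h1
  have h2 : ‖g s‖ ^ 2 ≤ 1 / R * (∫ x in (0 : ℝ)..R, ‖g x‖ ^ 2) + W := by
    rw [one_div, ← div_eq_inv_mul, ← sub_le_iff_le_add, le_div_iff₀ hR]
    linarith
  rw [hWe] at h2
  linarith

theorem inner_eq_intervalIntegral (hR : 0 ≤ R) {f h : SchSp R} {g h0 : ℝ → ℂ}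
    (hf : ∀ᵐ x ∂(volume.restrict (Set.Ioo (0 : ℝ) R)), f x = g x)
    (hh : ∀ᵐ x ∂(volume.restrict (Set.Ioo (0 : ℝ) R)), h x = h0 x) :
    ⟪f, h⟫_ℂ = ∫ x in (0 : ℝ)..R, h0 x * starRingEnd ℂ (g x) := by
  rw [L2.inner_def, intervalIntegral.integral_of_le hR, integral_Ioc_eq_integral_Ioo]
  refine integral_congr_ae ?_
  filter_upwards [hf, hh] with x h1 h2
  rw [h1, h2]
  simp [RCLike.inner_apply]

/-- Green's identity. -/
theorem SolvesAt.inner_eq (hR : 0 < R) {V : ℝ → ℝ}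
    (hV : IntervalIntegrable V volume 0 R) {f h : SchSp R}
    (H : SolvesAt R (fun x => (V x : ℂ)) 0 f h g dg) :
    ContinuousOn dg (Set.Icc 0 R) ∧
    ⟪f, h⟫_ℂ = (((∫ x in (0 : ℝ)..R, V x * ‖g x‖ ^ 2) + ∫ x in (0 : ℝ)..R, ‖dg x‖ ^ 2 : ℝ) : ℂ) -
      (dg R * starRingEnd ℂ (g R) - dg 0 * starRingEnd ℂ (g 0)) := by
  obtain ⟨hf, hg, h0, hh, hd⟩ := H
  have hVc : IntervalIntegrable (fun x => (V x : ℂ)) volume 0 R := ⟨hV.1.ofReal, hV.2.ofReal⟩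
  have hgc := continuousOn_of_hasDerivWithinAt_Icc hg
  have hp := intervalIntegrable_rhs hR.le hVc 0 hgc hh
  have hdg : ContinuousOn dg (Set.Icc 0 R) := by
    have := (absolutelyContinuousOnInterval_primitive hp).continuousOn
    rw [Set.uIcc_of_le hR.le] at this
    exact (this.const_add (dg 0)).congr hd
  refine ⟨hdg, ?_⟩
  have hdgi' : IntervalIntegrable (fun x => starRingEnd ℂ (dg x)) volume 0 R :=
    ContinuousOn.intervalIntegrable (by
      rw [Set.uIcc_of_le hR.le]
      exact Complex.continuous_conj.comp_continuousOn hdg)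
  have key := integral_deriv_mul_primitive (F := dg) (G := fun x => starRingEnd ℂ (g x)) hR.le
    hp hdgi' hd (fun x hx => conj_eq_add_integral hg hdg hx)
  have i1 : IntervalIntegrable (fun x => V x * ‖g x‖ ^ 2) volume 0 R :=
    hV.mul_continuousOn (by rw [Set.uIcc_of_le hR.le]; fun_prop)
  have i2 : IntervalIntegrable (fun x => ‖dg x‖ ^ 2) volume 0 R :=
    ContinuousOn.intervalIntegrable (by rw [Set.uIcc_of_le hR.le]; fun_prop)
  have i3 : IntervalIntegrable (fun x => h0 x * starRingEnd ℂ (g x)) volume 0 R :=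
    (intervalIntegrable_of_coeFn_ae_eq hR.le h hh).mul_continuousOn (by
      rw [Set.uIcc_of_le hR.le]
      exact Complex.continuous_conj.comp_continuousOn hgc)
  have i12 := i1.add i2
  have i12' : IntervalIntegrable (fun x => ((V x * ‖g x‖ ^ 2 + ‖dg x‖ ^ 2 : ℝ) : ℂ)) volume 0 R :=
    ⟨i12.1.ofReal, i12.2.ofReal⟩
  have e : ∫ x in (0 : ℝ)..R, (((V x : ℂ) * g x - 0 * g x - h0 x) * starRingEnd ℂ (g x) +
      dg x * starRingEnd ℂ (dg x)) =
      ∫ x in (0 : ℝ)..R, (((V x * ‖g x‖ ^ 2 + ‖dg x‖ ^ 2 : ℝ) : ℂ) -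
        h0 x * starRingEnd ℂ (g x)) := by
    refine intervalIntegral.integral_congr fun x _ => ?_
    have h1 : g x * starRingEnd ℂ (g x) = ((‖g x‖ ^ 2 : ℝ) : ℂ) := by
      rw [Complex.mul_conj, Complex.normSq_eq_norm_sq]
    have h2 : dg x * starRingEnd ℂ (dg x) = ((‖dg x‖ ^ 2 : ℝ) : ℂ) := by
      rw [Complex.mul_conj, Complex.normSq_eq_norm_sq]
    rw [h2]
    push_cast at h1 ⊢
    linear_combination (V x : ℂ) * h1
  rw [e, intervalIntegral.integral_sub i12' i3, intervalIntegral.integral_ofReal,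
    intervalIntegral.integral_add i1 i2] at key
  rw [inner_eq_intervalIntegral hR.le hf hh, ← key]
  ring

/-- Schrödinger operators with separated self-adjoint boundary conditions are semibounded. -/
theorem IsSchrodingerOp.exists_semibound (hR : 0 < R) {V : ℝ → ℝ}
    (hV : IntervalIntegrable V volume 0 R) {t0 tR : ℝ} {A : SchSp R →ₗ.[ℂ] SchSp R}
    (hA : IsSchrodingerOp R (fun x => (V x : ℂ)) t0 tR A) :
    ∃ C : ℝ, ∀ u : A.domain, -C * ‖(u : SchSp R)‖ ^ 2 ≤ (⟪(u : SchSp R), A u⟫_ℂ).re := by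
  obtain ⟨c0, hc0, h0⟩ := exists_norm_mul_conj_le_of_cos_sin t0
  obtain ⟨cR, hcR, hcR'⟩ := exists_norm_mul_conj_le_of_cos_sin (-tR)
  have hVn : 0 ≤ ∫ x in (0 : ℝ)..R, |V x| :=
    intervalIntegral.integral_nonneg hR.le fun _ _ => abs_nonneg _
  set K : ℝ := (∫ x in (0 : ℝ)..R, |V x|) + c0 + cR + 1 with hK
  have hKpos : 0 < K := by linarith
  refine ⟨K * (1 / R + K), fun u => ?_⟩
  obtain ⟨g, dg, H, hb⟩ := (hA _ _).1 (A.mem_graph u)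
  obtain ⟨hdg, hin⟩ := H.inner_eq hR hV
  obtain ⟨hf, hg, -⟩ := H
  have hgc := continuousOn_of_hasDerivWithinAt_Icc hg
  have hnorm : ‖(u : SchSp R)‖ ^ 2 = ∫ x in (0 : ℝ)..R, ‖g x‖ ^ 2 := by
    have h1 := inner_eq_intervalIntegral hR.le hf hf
    rw [inner_self_eq_ofReal_norm_sq] at h1
    have h2 : ∫ x in (0 : ℝ)..R, g x * starRingEnd ℂ (g x) =
        ((∫ x in (0 : ℝ)..R, ‖g x‖ ^ 2 : ℝ) : ℂ) := by
      rw [← intervalIntegral.integral_ofReal]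
      refine intervalIntegral.integral_congr fun x _ => ?_
      simp only [Complex.mul_conj, Complex.normSq_eq_norm_sq]
    rw [h2] at h1
    exact_mod_cast h1
  set N := ∫ x in (0 : ℝ)..R, ‖g x‖ ^ 2
  set D := ∫ x in (0 : ℝ)..R, ‖dg x‖ ^ 2
  have hN : 0 ≤ N := intervalIntegral.integral_nonneg hR.le fun _ _ => by positivity
  have hD : 0 ≤ D := intervalIntegral.integral_nonneg hR.le fun _ _ => by positivity
  set M := (1 / R + K) * N + 1 / K * D with hM
  have hMnn : 0 ≤ M := by positivity
  have hsob : ∀ s ∈ Set.Icc 0 R, ‖g s‖ ^ 2 ≤ M := fun s hs => by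
    have := norm_sq_le_of_hasDerivWithinAt hR hg hdg (one_div_pos.2 hKpos) hs
    rwa [one_div_one_div] at this
  have hb0 : ‖dg 0 * starRingEnd ℂ (g 0)‖ ≤ c0 * M := by
    refine (h0 _ _ ?_).trans (mul_le_mul_of_nonneg_left (hsob 0 ⟨le_rfl, hR.le⟩) hc0)
    simpa [bdryC] using congr_fun hb 0
  have hbR : ‖dg R * starRingEnd ℂ (g R)‖ ≤ cR * M := by
    refine (hcR' _ _ ?_).trans (mul_le_mul_of_nonneg_left (hsob R ⟨hR.le, le_rfl⟩) hcR)
    simpa [bdryC, sub_eq_add_neg] using congr_fun hb 1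
  have hVb : -(∫ x in (0 : ℝ)..R, |V x|) * M ≤ ∫ x in (0 : ℝ)..R, V x * ‖g x‖ ^ 2 := by
    rw [← intervalIntegral.integral_neg, ← intervalIntegral.integral_mul_const]
    refine intervalIntegral.integral_mono_on hR.le (hV.abs.neg.mul_const _)
      (hV.mul_continuousOn (by rw [Set.uIcc_of_le hR.le]; fun_prop)) fun x hx => ?_
    have h1 := hsob x hx
    have h2 : 0 ≤ ‖g x‖ ^ 2 := by positivity
    have h3 := neg_abs_le (V x)
    nlinarith [abs_nonneg (V x)]
  have hre : (⟪(u : SchSp R), A u⟫_ℂ).re = (∫ x in (0 : ℝ)..R, V x * ‖g x‖ ^ 2) + D -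
      ((dg R * starRingEnd ℂ (g R)).re - (dg 0 * starRingEnd ℂ (g 0)).re) := by
    rw [hin, Complex.sub_re, Complex.sub_re, Complex.ofReal_re]
  have r0 := (abs_le.1 (Complex.abs_re_le_norm (dg 0 * starRingEnd ℂ (g 0)))).1
  have rR := (abs_le.1 (Complex.abs_re_le_norm (dg R * starRingEnd ℂ (g R)))).2
  have hKM : K * M = K * (1 / R + K) * N + D := by
    rw [hM]
    field_simp
  have hKM' : K * M = (∫ x in (0 : ℝ)..R, |V x|) * M + c0 * M + cR * M + M := by
    rw [hK]
    ring
  rw [hre, hnorm]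
  linarith

end Semibounded

section Main

theorem mem_resolventSetP_of_mem_offCut_einf {R : ℝ} {A A' : SchSp R →ₗ.[ℂ] SchSp R}
    (hA : IsSelfAdjoint A) (hA' : IsSelfAdjoint A') {C C' : ℝ}
    (hC : ∀ u : A.domain, -C * ‖(u : SchSp R)‖ ^ 2 ≤ (⟪(u : SchSp R), A u⟫_ℂ).re)
    (hC' : ∀ u : A'.domain, -C' * ‖(u : SchSp R)‖ ^ 2 ≤ (⟪(u : SchSp R), A' u⟫_ℂ).re)
    {z : ℂ} (hz : z ∈ offCut (einf R A A')) :
    z ∈ resolventSetP A ∧ z ∈ resolventSetP A' := by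
  by_cases him : z.im = 0
  · have hzr : z.re < einf R A A' := hz.resolve_left (not_not.2 him)
    have hze : ((z.re : ℝ) : ℂ) = z := by
      apply Complex.ext <;> simp [him]
    have hbdd : BddBelow {x : ℝ | (x : ℂ) ∈ specP A ∪ specP A'} := by
      refine ⟨min (-C) (-C'), fun x hx => ?_⟩
      by_contra! hlt
      obtain ⟨h1, h2⟩ := lt_min_iff.1 hlt
      rcases hx with hx | hx
      · exact hx (mem_resolventSetP_of_semibounded hA hC h1)
      · exact hx (mem_resolventSetP_of_semibounded hA' hC' h2)
    have hnot : z ∉ specP A ∪ specP A' := fun hmem =>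
      (csInf_le hbdd (by rwa [Set.mem_ofPred_eq, hze])).not_gt hzr
    exact ⟨not_not.1 fun h => hnot (Or.inl h), not_not.1 fun h => hnot (Or.inr h)⟩
  · exact ⟨mem_resolventSetP_of_im_ne_zero hA him, mem_resolventSetP_of_im_ne_zero hA' him⟩

end Main

/-- Theorem 4.2: for real `V`, the resolvent difference is trace class
and `tr((H' - z)⁻¹ - (H - z)⁻¹) = -tr(Λ(z)⁻¹ Λ'(z)) = -(d/dz) ln det Λ(z)`
(the latter expressed as `-det'(z)/det Λ(z)`). -/
theorem statement17
    (Rr : ℝ) (hR : 0 < Rr) (V : ℝ → ℝ)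
    (hV : MeasureTheory.IntegrableOn V (Set.Ioo 0 Rr) MeasureTheory.volume)
    (t0 tR t0' tR' : ℝ)
    (ht0 : t0 ∈ Set.Ico 0 (2 * Real.pi)) (htR : tR ∈ Set.Ico 0 (2 * Real.pi))
    (ht0' : t0' ∈ Set.Ico 0 (2 * Real.pi)) (htR' : tR' ∈ Set.Ico 0 (2 * Real.pi))
    (Hop Hop' : SchSp Rr →ₗ.[ℂ] SchSp Rr)
    (hHop : IsSchrodingerOp Rr (fun x => (V x : ℂ)) (t0 : ℂ) (tR : ℂ) Hop)
    (hHop' : IsSchrodingerOp Rr (fun x => (V x : ℂ)) (t0' : ℂ) (tR' : ℂ) Hop')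
    (hsa : IsSelfAdjoint Hop) (hsa' : IsSelfAdjoint Hop')
    (b : HilbertBasis ℕ ℂ (SchSp Rr))
    (Λ : ℂ → Matrix (Fin 2) (Fin 2) ℂ)
    (hΛ : ∀ z ∈ offCut (einf Rr Hop Hop'),
      IsBoundaryDataMap Rr (fun x => (V x : ℂ)) (t0 : ℂ) (tR : ℂ) (t0' : ℂ) (tR' : ℂ) z (Λ z)) :
    ∀ z ∈ offCut (einf Rr Hop Hop'),
      IsTraceClass (res Hop' z - res Hop z) ∧
      (∃ Λd : Matrix (Fin 2) (Fin 2) ℂ,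
        (∀ i j : Fin 2,
          HasDerivWithinAt (fun w => Λ w i j) (Λd i j) (offCut (einf Rr Hop Hop')) z) ∧
        traceH b (res Hop' z - res Hop z) = -Matrix.trace ((Λ z)⁻¹ * Λd)) ∧
      ∃ dd : ℂ,
        HasDerivWithinAt (fun w => (Λ w).det) dd (offCut (einf Rr Hop Hop')) z ∧
        traceH b (res Hop' z - res Hop z) = -(dd / (Λ z).det) := by
  have hVi : IntervalIntegrable V volume 0 Rr :=
    (intervalIntegrable_iff_integrableOn_Ioo_of_le hR.le).2 hV
  have hVc : IntervalIntegrable (fun x => (V x : ℂ)) volume 0 Rr :=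
    ⟨hVi.1.ofReal, hVi.2.ofReal⟩
  obtain ⟨C, hC⟩ := hHop.exists_semibound hR hVi
  obtain ⟨C', hC'⟩ := hHop'.exists_semibound hR hVi
  have hG := isBoundaryRelation_boundaryRelation hR hVc hHop hHop'
  intro z hz
  refine hG.trace_formula
    (fun w hw => (mem_resolventSetP_of_mem_offCut_einf hsa hsa' hC hC' hw).1)
    (fun w hw => (mem_resolventSetP_of_mem_offCut_einf hsa hsa' hC hC' hw).2) ?_ b hz
  rintro w hw f c c' ⟨g, dg, H, rfl, rfl⟩
  exact hΛ w hw g dg H.solODE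

end
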